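/- arXiv:2111.06315 — 8 statements merged into one kernel-verified Lean document; each statement's English description precedes it below -/
import Mathlib

section
/- There exists δ > 0 such that y_i(t) ≥ δ for every i ∈ {1,…,m} and every t ∈ ℕ; that is, δ := inf_{1≤i≤m, t∈ℕ} y_i(t) > 0. -/
open Finset

/-- A convolution of two summable nonnegative sequences tends to zero. -/
theorem tendsto_sum_range_mul_of_summable {f g : ℕ → ℝ} (hf : Summable f) (hg : Summable g)
    (hf0 : ∀ n, 0 ≤ f n) (hg0 : ∀ n, 0 ≤ g n) :
    Filter.Tendsto (fun n => ∑ s ∈ range (n + 1), f s * g (n - s)) Filter.atTop (nhds 0) := by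
  have h := (summable_norm_sum_mul_antidiagonal_of_summable_norm
    (f := f) (g := g) (by simpa [abs_of_nonneg, hf0] using hf)
    (by simpa [abs_of_nonneg, hg0] using hg)).of_norm.tendsto_atTop_zero
  refine h.congr fun n => ?_
  exact Finset.Nat.sum_antidiagonal_eq_sum_range_succ_mk (fun p : ℕ × ℕ => f p.1 * g p.2) n

/-- Variation of constants for `y (t + 1) = A t (y t + θ t)`, with the initial value absorbed in
the input `x`. -/
theorem eq_sum_transition_mul_input {m : ℕ} {A : ℕ → Matrix (Fin m) (Fin m) ℝ}
    {Aprod : ℕ → ℕ → Matrix (Fin m) (Fin m) ℝ}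
    (hdiag : ∀ s, Aprod s s = A s)
    (hsucc : ∀ s t, s ≤ t → Aprod (t + 1) s = A (t + 1) * Aprod t s)
    {x y : ℕ → Fin m → ℝ} (hy0 : ∀ i, y 1 i = ∑ j, A 0 i j * x 0 j)
    (hy : ∀ t i, y (t + 2) i = ∑ j, A (t + 1) i j * (y (t + 1) j + x (t + 1) j)) (t : ℕ)
    (i : Fin m) :
    y (t + 1) i = ∑ s ∈ range (t + 1), ∑ j, Aprod t s i j * x s j := by
  induction t generalizing i with
  | zero => simp [hy0, hdiag]
  | succ t ih =>
    rw [sum_range_succ, hdiag, hy]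
    simp only [mul_add, sum_add_distrib, add_left_inj]
    have h : ∀ s ∈ range (t + 1), ∑ j, Aprod (t + 1) s i j * x s j
        = ∑ k, A (t + 1) i k * ∑ j, Aprod t s k j * x s j := by
      intro s hs
      rw [hsucc s t (Nat.lt_succ_iff.mp (mem_range.mp hs))]
      simp only [Matrix.mul_apply, sum_mul, mul_sum]
      rw [sum_comm]
      simp only [mul_assoc]
    rw [sum_congr rfl h, sum_comm]
    simp only [ih, mul_sum]

theorem transition_nonneg {m : ℕ} {A : ℕ → Matrix (Fin m) (Fin m) ℝ}
    {Aprod : ℕ → ℕ → Matrix (Fin m) (Fin m) ℝ} (hA : ∀ t i j, 0 ≤ A t i j)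
    (hdiag : ∀ s, Aprod s s = A s)
    (hsucc : ∀ s t, s ≤ t → Aprod (t + 1) s = A (t + 1) * Aprod t s) {s t : ℕ} (hst : s ≤ t)
    (i j : Fin m) : 0 ≤ Aprod t s i j := by
  induction t, hst using Nat.le_induction generalizing i with
  | base => simpa [hdiag] using hA s i j
  | succ t hst ih =>
    rw [hsucc s t hst, Matrix.mul_apply]
    exact sum_nonneg fun k _ => mul_nonneg (hA _ _ _) (ih k)

theorem iInf_iInf_le_of_nonneg {m : ℕ} {f : ℕ → Fin m → ℝ} (hf : ∀ t i, 0 ≤ f t i) (t : ℕ)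
    (i : Fin m) : ⨅ (t : ℕ) (i : Fin m), f t i ≤ f t i :=
  (ciInf_le ⟨0, by rintro _ ⟨t, rfl⟩; exact Real.iInf_nonneg (hf t)⟩ t).trans
    (ciInf_le (Set.finite_range _).bddBelow i)

/-- An infimum of positive values that are eventually bounded away from zero is positive. -/
theorem iInf_iInf_pos_of_eventually {m : ℕ} [NeZero m] {y : ℕ → Fin m → ℝ}
    (hy : ∀ t i, 0 < y t i) {c : ℝ} (hc : 0 < c)
    (h : ∀ᶠ t in Filter.atTop, ∀ i, c ≤ y t i) : 0 < ⨅ (t : ℕ) (i : Fin m), y t i := by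
  obtain ⟨N, hN⟩ := Filter.eventually_atTop.mp h
  obtain ⟨p, -, hp⟩ := exists_min_image (range (N + 1) ×ˢ (univ : Finset (Fin m)))
    (fun p => y p.1 p.2) ⟨(0, 0), by simp⟩
  refine (lt_min hc (hy p.1 p.2)).trans_le (le_ciInf fun t => le_ciInf fun i => ?_)
  rcases le_total N t with ht | ht
  · exact (min_le_left _ _).trans (hN t ht i)
  · exact (min_le_right _ _).trans
      (hp (t, i) (mem_product.mpr ⟨mem_range.mpr (Nat.lt_succ_of_le ht), mem_univ i⟩))

/-- If the transition matrices are close to having constant rows `φ t`, a superposition of inputs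
is close to `φ t` times the total mass of the inputs. -/
theorem mul_sum_sub_le_sum_transition {m : ℕ} {P : ℕ → Matrix (Fin m) (Fin m) ℝ}
    {φ : Fin m → ℝ} {e g : ℕ → ℝ} {x : ℕ → Fin m → ℝ} (t : ℕ)
    (hP : ∀ s ≤ t, ∀ i j, |P s i j - φ i| ≤ e s) (hx : ∀ s j, |x s j| ≤ g s) (i : Fin m) :
    φ i * ∑ s ∈ range (t + 1), ∑ j, x s j - m * ∑ s ∈ range (t + 1), g s * e s
      ≤ ∑ s ∈ range (t + 1), ∑ j, P s i j * x s j := by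
  rw [mul_sum, mul_sum, ← sum_sub_distrib]
  refine sum_le_sum fun s hs => ?_
  have h : ∑ j, (φ i * x s j - g s * e s) ≤ ∑ j, P s i j * x s j := by
    refine sum_le_sum fun j _ => ?_
    have h1 : |(P s i j - φ i) * x s j| ≤ e s * g s := by
      rw [abs_mul]
      have h2 := hP s (Nat.lt_succ_iff.mp (mem_range.mp hs)) i j
      exact mul_le_mul h2 (hx s j) (abs_nonneg _) ((abs_nonneg _).trans h2)
    linarith [neg_le_of_abs_le h1]
  simpa [sum_sub_distrib, mul_sum] using h

/-- Under the perturbed push-sum dynamics `y(0) = 1_m`,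
`y(t+1) = A(t)(y(t) + θ(t))`, with the mixing estimate, `Q > 0`, `ζ` non-increasing
with `∑ t^{3/2} ζ(t) < ∞` and `∑_{t≥1} ζ(t) < 1`, `|θ_j(s)| ≤ ζ(s)`, and
`min_i y_i(t) > 0` for each fixed `t`, the uniform infimum
`δ := inf_{1≤i≤m, t∈ℕ} y_i(t)` is positive. -/
theorem stmt_2
    (m : ℕ) (hm : 1 ≤ m)
    (A : ℕ → Matrix (Fin m) (Fin m) ℝ)
    (hA_nonneg : ∀ t i j, 0 ≤ A t i j)
    (hA_col : ∀ t j, ∑ i, A t i j = 1)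
    (Aprod : ℕ → ℕ → Matrix (Fin m) (Fin m) ℝ)
    (hAprod_diag : ∀ s, Aprod s s = A s)
    (hAprod_succ : ∀ s t, s ≤ t → Aprod (t + 1) s = A (t + 1) * Aprod t s)
    (φ : ℕ → Fin m → ℝ)
    (hφ_nonneg : ∀ t i, 0 ≤ φ t i) (hφ_sum : ∀ t, ∑ i, φ t i = 1)
    (C₀ lam : ℝ) (hC₀ : 1 ≤ C₀) (hlam : lam ∈ Set.Ioo (0 : ℝ) 1)
    (hmix : ∀ s t, s ≤ t → ∀ i j, |Aprod t s i j - φ t i| ≤ C₀ * lam ^ (t - s))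
    (Q : ℝ) (hQdef : Q = ⨅ (t : ℕ) (i : Fin m), ∑ j, Aprod t 0 i j) (hQ : 0 < Q)
    (ζ : ℕ → ℝ) (hζ_nonneg : ∀ t, 0 ≤ ζ t) (hζ_mono : Antitone ζ)
    (hζ32 : Summable (fun t : ℕ => (t : ℝ) ^ (3/2 : ℝ) * ζ t))
    (hζ1 : ∑' t : ℕ, ζ (t + 1) < 1)
    (θ : ℕ → Fin m → ℝ) (hθ0 : θ 0 = 0)
    (hθ : ∀ s : ℕ, 1 ≤ s → ∀ j, |θ s j| ≤ ζ s)
    (y : ℕ → Fin m → ℝ)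
    (hy0 : ∀ i, y 0 i = 1)
    (hy : ∀ t i, y (t + 1) i = ∑ j, A t i j * (y t j + θ t j))
    (hypos : ∀ t i, 0 < y t i) :
    0 < ⨅ (t : ℕ) (i : Fin m), y t i := by
  have : NeZero m := ⟨by omega⟩
  have hζs : Summable fun t => ζ (t + 1) := by
    refine ((summable_nat_add_iff 1).mpr hζ32).of_nonneg_of_le (fun t => hζ_nonneg _) fun t => ?_
    refine le_mul_of_one_le_left (hζ_nonneg _) (Real.one_le_rpow ?_ (by norm_num))
    push_cast
    linarith [(Nat.cast_nonneg t : (0 : ℝ) ≤ t)]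
  set η := 1 - ∑' t : ℕ, ζ (t + 1)
  have hη : 0 < η := sub_pos.mpr hζ1
  let x : ℕ → Fin m → ℝ := fun s j => if s = 0 then 1 else θ s j
  let g : ℕ → ℝ := fun s => if s = 0 then 1 else ζ s
  have hx : ∀ s j, |x s j| ≤ g s := by
    intro s j
    rcases Nat.eq_zero_or_pos s with rfl | hs
    · simp [x, g]
    · simpa [x, g, hs.ne'] using hθ s hs j
  have hg0 : ∀ s, 0 ≤ g s := fun s => (abs_nonneg _).trans (hx s 0)
  have hg : Summable g := (summable_nat_add_iff 1).mp (by simpa [g] using hζs)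
  have hrep := eq_sum_transition_mul_input hAprod_diag hAprod_succ (x := x) (y := y)
    (by simp [hy, hy0, hθ0, x]) (by simp [hy _, x])
  have hmass : ∀ t, m * η ≤ ∑ s ∈ range (t + 1), ∑ j, x s j := by
    intro t
    have h1 : -(m * ∑ s ∈ range t, ζ (s + 1)) ≤ ∑ s ∈ range t, ∑ j, x (s + 1) j := by
      rw [mul_sum, ← sum_neg_distrib]
      refine sum_le_sum fun s _ => ?_
      have h2 : ∑ _j : Fin m, -ζ (s + 1) ≤ ∑ j, x (s + 1) j :=
        sum_le_sum fun j _ => neg_le_of_abs_le (hθ (s + 1) (by omega) j)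
      simpa using h2
    have h3 : (m : ℝ) * ∑ s ∈ range t, ζ (s + 1) ≤ m * ∑' s, ζ (s + 1) :=
      mul_le_mul_of_nonneg_left (hζs.sum_le_tsum _ fun s _ => hζ_nonneg _) (Nat.cast_nonneg m)
    have h4 : ∑ j, x 0 j = m := by simp [x]
    rw [sum_range_succ', h4, mul_sub]
    linarith
  have hφ : ∀ t i, Q - m * (C₀ * lam ^ t) ≤ m * φ t i := by
    intro t i
    have h1 : Q ≤ ∑ j, Aprod t 0 i j := hQdef ▸ iInf_iInf_le_of_nonneg (fun t i =>
      sum_nonneg fun j _ =>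
        transition_nonneg hA_nonneg hAprod_diag hAprod_succ (Nat.zero_le t) i j) t i
    have h2 : ∑ j, Aprod t 0 i j ≤ ∑ _j : Fin m, (φ t i + C₀ * lam ^ t) :=
      sum_le_sum fun j _ =>
        sub_le_iff_le_add'.mp (le_of_abs_le (hmix 0 t (Nat.zero_le t) i j))
    rw [sum_const, card_univ, Fintype.card_fin, nsmul_eq_mul, mul_add] at h2
    linarith
  let E : ℕ → ℝ := fun t =>
    (Q - m * (C₀ * lam ^ t)) * η - m * ∑ s ∈ range (t + 1), g s * (C₀ * lam ^ (t - s))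
  have hlow : ∀ t i, E t ≤ y (t + 1) i := by
    intro t i
    rw [hrep]
    refine le_trans ?_ (mul_sum_sub_le_sum_transition (e := fun s => C₀ * lam ^ (t - s)) t
      (fun s hs => hmix s t hs) hx i)
    refine sub_le_sub_right ?_ _
    have h1 := mul_le_mul_of_nonneg_right (hφ t i) hη.le
    have h2 := mul_le_mul_of_nonneg_left (hmass t) (hφ_nonneg t i)
    linarith
  have hE : Filter.Tendsto E Filter.atTop (nhds ((Q - m * (C₀ * 0)) * η - m * 0)) := by
    have hlam0 := tendsto_pow_atTop_nhds_zero_of_lt_one hlam.1.le hlam.2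
    have hconv := tendsto_sum_range_mul_of_summable hg
      ((summable_geometric_of_lt_one hlam.1.le hlam.2).mul_left C₀) hg0
      fun n => mul_nonneg (by linarith) (pow_nonneg hlam.1.le n)
    exact ((tendsto_const_nhds.sub ((hlam0.const_mul C₀).const_mul (m : ℝ))).mul_const η).sub
      (hconv.const_mul (m : ℝ))
  have hQη : 0 < Q * η := mul_pos hQ hη
  have hev := hE.eventually_const_le (u := Q * η / 2) (by simp only [mul_zero, sub_zero]; linarith)
  refine iInf_iInf_pos_of_eventually hypos (half_pos hQη) ?_
  rw [← Filter.map_add_atTop_eq_nat 1, Filter.eventually_map]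
  exact hev.mono fun t ht i => ht.trans (hlow t i)
end

section
/- Assume each f_i is convex, that ζ is non-increasing with ∑_{t=1}^∞ ζ(t) < 1 (so that B_ζ > 0), and that α(t+1) > 0. Then for every t ≥ 0 and every x ∈ ℝ^d: ∑_{i=1}^m (f_i(B_ζ x̄(t)) − f_i(x)) ≤ (m/(2α(t+1)B_ζ))(‖B_ζ x̄(t) − x‖² − ‖B_ζ x̄(t+1) − x‖²) + (B_ζ m/(2α(t+1)))(2α(t+1)²D² + 2τ(t)²) + (m/α(t+1))‖B_ζ x̄(t) − x‖τ(t) + 2D∑_{i=1}^m ‖ẑ_i(t+1) − B_ζ x̄(t)‖. -/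
open Finset Filter

/-- First-order characterisation of convexity: a convex function lies above its tangent plane. -/
lemma ConvexOn.inner_gradient_le_sub {E : Type*} [NormedAddCommGroup E] [InnerProductSpace ℝ E]
    [CompleteSpace E] {f : E → ℝ} {v a : E} (hf : ConvexOn ℝ Set.univ f)
    (hv : HasGradientAt f v a) (b : E) : inner ℝ v (b - a) ≤ f b - f a := by
  have hline : ConvexOn ℝ Set.univ (f ∘ AffineMap.lineMap (k := ℝ) a b) := by
    simpa using hf.comp_affineMap (AffineMap.lineMap a b)
  have hderiv : HasDerivAt (f ∘ AffineMap.lineMap (k := ℝ) a b) (inner ℝ v (b - a)) 0 := by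
    have h := hv.hasFDerivAt
    rw [← AffineMap.lineMap_apply_zero (k := ℝ) a b] at h
    simpa using h.comp_hasDerivAt (0 : ℝ) AffineMap.hasDerivAt_lineMap
  simpa [slope] using hline.le_slope_of_hasDerivAt (Set.mem_univ 0) (Set.mem_univ 1) one_pos hderiv

/-- Comparison of a convex function at two points `b`, `c` through a bounded gradient at a third
point `a`. -/
lemma ConvexOn.sub_le_inner_gradient_add {E : Type*} [NormedAddCommGroup E]
    [InnerProductSpace ℝ E] [CompleteSpace E] {f : E → ℝ} {g : E → E} {D : ℝ}
    (hf : ConvexOn ℝ Set.univ f) (hg : ∀ a, HasGradientAt f (g a) a) (hD : ∀ a, ‖g a‖ ≤ D)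
    (a b c : E) : f b - f c ≤ inner ℝ (g a) (b - c) + 2 * D * ‖a - b‖ := by
  have h₁ := hf.inner_gradient_le_sub (hg b) a
  have h₂ := hf.inner_gradient_le_sub (hg a) c
  have h₃ : -inner ℝ (g b) (a - b) ≤ D * ‖a - b‖ :=
    (neg_le_abs _).trans <| (abs_real_inner_le_norm _ _).trans <| by gcongr; exact hD b
  have h₄ : inner ℝ (g a) (a - b) ≤ D * ‖a - b‖ :=
    (real_inner_le_norm _ _).trans <| by gcongr; exact hD a
  have h₅ : inner ℝ (g a) (b - c) = -inner ℝ (g a) (a - b) - inner ℝ (g a) (c - a) := by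
    simp only [inner_sub_right]; ring
  linarith

/-- The norm of an average is bounded by a common bound on the norms. -/
lemma norm_average_le {ι E : Type*} [Fintype ι] [Nonempty ι] [NormedAddCommGroup E]
    [NormedSpace ℝ E] {v : ι → E} {C : ℝ} (h : ∀ i, ‖v i‖ ≤ C) :
    ‖(Fintype.card ι : ℝ)⁻¹ • ∑ i, v i‖ ≤ C := by
  have hc : (0 : ℝ) < Fintype.card ι := by exact_mod_cast Fintype.card_pos
  rw [norm_smul, norm_inv, Real.norm_natCast, inv_mul_le_iff₀ hc]
  simpa using norm_sum_le_of_le univ fun i _ => h i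

/-- If the entries of `θ s` are bounded by `ζ s` and `∑ ζ < 1`, then the number of entries plus the
sum of all entries is positive. -/
lemma card_add_tsum_sum_pos {ι : Type*} [Fintype ι] [Nonempty ι] {θ : ℕ → ι → ℝ} {ζ : ℕ → ℝ}
    (h : ∀ s j, |θ s j| ≤ ζ s) (hs : Summable ζ) (h₁ : ∑' s, ζ s < 1) :
    0 < (Fintype.card ι : ℝ) + ∑' s, ∑ j, θ s j := by
  have hc : (0 : ℝ) < Fintype.card ι := by exact_mod_cast Fintype.card_pos
  have hb : ‖∑' s, ∑ j, θ s j‖ ≤ Fintype.card ι * ∑' s, ζ s :=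
    tsum_of_norm_bounded (hs.hasSum.mul_left _) fun s => by
      simpa using norm_sum_le_of_le univ (f := θ s) fun j _ => h s j
  have := neg_le_of_abs_le hb
  nlinarith

/-- One step of a perturbed gradient descent, with step `α`, perturbation `e` and direction `v`. -/
lemma inner_le_of_perturbed_step {E : Type*} [NormedAddCommGroup E] [InnerProductSpace ℝ E]
    {u e v : E} {B α τ D : ℝ} (hB : 0 < B) (hα : 0 < α) (he : ‖e‖ ≤ τ) (hv : ‖v‖ ≤ D) :
    inner ℝ v u ≤ 1 / (2 * α * B) * (‖u‖ ^ 2 - ‖u + B • (e - α • v)‖ ^ 2)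
      + B / (2 * α) * (2 * α ^ 2 * D ^ 2 + 2 * τ ^ 2) + 1 / α * ‖u‖ * τ := by
  have hexp : ‖u + B • (e - α • v)‖ ^ 2
      = ‖u‖ ^ 2 + 2 * B * (inner ℝ u e - α * inner ℝ v u) + B ^ 2 * ‖e - α • v‖ ^ 2 := by
    rw [norm_add_sq_real, norm_smul, mul_pow, Real.norm_eq_abs, sq_abs, inner_smul_right,
      inner_sub_right, inner_smul_right, real_inner_comm u v]
    ring
  have hue : inner ℝ u e ≤ ‖u‖ * τ := (real_inner_le_norm _ _).trans (by gcongr)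
  have hsq : ‖e - α • v‖ ^ 2 ≤ 2 * α ^ 2 * D ^ 2 + 2 * τ ^ 2 := by
    have hle : ‖e - α • v‖ ≤ τ + α * D := by
      refine (norm_sub_le _ _).trans ?_
      rw [norm_smul, Real.norm_of_nonneg hα.le]
      gcongr
    have := pow_le_pow_left₀ (norm_nonneg _) hle 2
    nlinarith [sq_nonneg (τ - α * D)]
  have hkey : 2 * α * B * inner ℝ v u ≤ (‖u‖ ^ 2 - ‖u + B • (e - α • v)‖ ^ 2)
      + B ^ 2 * (2 * α ^ 2 * D ^ 2 + 2 * τ ^ 2) + 2 * B * (‖u‖ * τ) := by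
    have h₁ := mul_le_mul_of_nonneg_left hue (by positivity : 0 ≤ 2 * B)
    have h₂ := mul_le_mul_of_nonneg_left hsq (sq_nonneg B)
    rw [hexp]
    linarith
  calc inner ℝ v u = (2 * α * B)⁻¹ * (2 * α * B * inner ℝ v u) := by field_simp
    _ ≤ (2 * α * B)⁻¹ * _ := mul_le_mul_of_nonneg_left hkey (by positivity)
    _ = _ := by field_simp

/-- Lemma `submain`: in the event-triggered gradient-push algorithm, if each
`f_i` is convex, `ζ` is non-increasing with `∑_{t≥1} ζ(t) < 1` (so `B_ζ > 0`) and
`α(t+1) > 0`, then for every `t ≥ 0` and `x ∈ ℝ^d`: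
`∑_i (f_i(B_ζ x̄(t)) − f_i(x)) ≤ (m/(2α(t+1)B_ζ))(‖B_ζ x̄(t) − x‖² − ‖B_ζ x̄(t+1) − x‖²)
 + (B_ζ m/(2α(t+1)))(2α(t+1)²D² + 2τ(t)²) + (m/α(t+1))‖B_ζ x̄(t) − x‖τ(t)
 + 2D ∑_i ‖ẑ_i(t+1) − B_ζ x̄(t)‖`. -/
theorem stmt_7
    (m d : ℕ) (hm : 1 ≤ m) (hd : 1 ≤ d)
    (A : ℕ → Matrix (Fin m) (Fin m) ℝ)
    (hA_nonneg : ∀ t i j, 0 ≤ A t i j)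
    (hA_col : ∀ t j, ∑ i, A t i j = 1)
    (α τ ζ : ℕ → ℝ)
    (hα_nonneg : ∀ t, 0 ≤ α t) (hτ_nonneg : ∀ t, 0 ≤ τ t) (hζ_nonneg : ∀ t, 0 ≤ ζ t)
    (D : ℝ)
    (f : Fin m → EuclideanSpace ℝ (Fin d) → ℝ)
    (g : Fin m → EuclideanSpace ℝ (Fin d) → EuclideanSpace ℝ (Fin d))
    (hgrad : ∀ i x, HasGradientAt (f i) (g i x) x)
    (hD : ∀ i x, ‖g i x‖ ≤ D)
    (x xh w z : ℕ → Fin m → EuclideanSpace ℝ (Fin d))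
    (y yh : ℕ → Fin m → ℝ)
    (hxh0 : ∀ i, xh 0 i = x 0 i)
    (hy0 : ∀ i, y 0 i = 1) (hyh0 : ∀ i, yh 0 i = 1)
    (hw : ∀ t i, w (t + 1) i = ∑ j, A t i j • xh t j)
    (hy : ∀ t i, y (t + 1) i = ∑ j, A t i j * yh t j)
    (hz : ∀ t i, z (t + 1) i = (y (t + 1) i)⁻¹ • w (t + 1) i)
    (hx : ∀ t i, x (t + 1) i = w (t + 1) i - α (t + 1) • g i (z (t + 1) i))
    (hxh_choice : ∀ t i, xh (t + 1) i = x (t + 1) i ∨ xh (t + 1) i = xh t i)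
    (hxh_err : ∀ t i, ‖xh (t + 1) i - x (t + 1) i‖ ≤ τ (t + 1))
    (hyh_choice : ∀ t i, yh (t + 1) i = y (t + 1) i ∨ yh (t + 1) i = yh t i)
    (hyh_err : ∀ t i, |yh (t + 1) i - y (t + 1) i| ≤ ζ (t + 1))
    (hypos : ∀ t i, 0 < y t i)
    (mζ : ℝ) (hmζ : mζ = m + ∑' s : ℕ, ∑ j, (yh (s + 1) j - y (s + 1) j))
    (Bζ : ℝ) (hBζ : Bζ = mζ / m)
    (xbar : ℕ → EuclideanSpace ℝ (Fin d))
    (hxbar : ∀ t, xbar t = (m : ℝ)⁻¹ • ∑ i, x t i)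
    (hconv : ∀ i, ConvexOn ℝ Set.univ (f i))
    (hζ_mono : Antitone ζ)
    (hζ_sum : Summable (fun s : ℕ => ζ (s + 1)))
    (hζ1 : ∑' s : ℕ, ζ (s + 1) < 1)
    (hα_pos : ∀ t : ℕ, 0 < α (t + 1)) :
    ∀ t : ℕ, ∀ xx : EuclideanSpace ℝ (Fin d),
      ∑ i, (f i (Bζ • xbar t) - f i xx) ≤
        (m / (2 * α (t + 1) * Bζ)) * (‖Bζ • xbar t - xx‖ ^ 2 - ‖Bζ • xbar (t + 1) - xx‖ ^ 2)
          + (Bζ * m / (2 * α (t + 1))) * (2 * α (t + 1) ^ 2 * D ^ 2 + 2 * τ t ^ 2)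
          + (m / α (t + 1)) * ‖Bζ • xbar t - xx‖ * τ t
          + 2 * D * ∑ i, ‖z (t + 1) i - Bζ • xbar t‖ := by
  intro t xx
  have : Nonempty (Fin m) := ⟨⟨0, hm⟩⟩
  have hm₀ : (0 : ℝ) < m := by exact_mod_cast hm
  have hB : 0 < Bζ := by
    rw [hBζ, hmζ]
    refine div_pos ?_ hm₀
    simpa using card_add_tsum_sum_pos (fun s => hyh_err s) hζ_sum hζ1
  have herr : ∀ i, ‖xh t i - x t i‖ ≤ τ t := by
    cases t with
    | zero => simpa [hxh0] using hτ_nonneg 0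
    | succ s => exact hxh_err s
  set e := (m : ℝ)⁻¹ • ∑ i, (xh t i - x t i) with he
  set v := (m : ℝ)⁻¹ • ∑ i, g i (z (t + 1) i) with hv
  have he_le : ‖e‖ ≤ τ t := by simpa only [Fintype.card_fin] using norm_average_le herr
  have hv_le : ‖v‖ ≤ D := by
    simpa only [Fintype.card_fin] using norm_average_le fun i => hD i (z (t + 1) i)
  have hmix : ∑ i, w (t + 1) i = ∑ j, xh t j := by
    simp_rw [hw]
    rw [sum_comm]
    simp_rw [← sum_smul, hA_col, one_smul]
  have hstep : xbar (t + 1) = xbar t + (e - α (t + 1) • v) := by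
    simp only [hxbar, he, hv, hx, sum_sub_distrib, hmix, ← smul_sum]
    module
  have hshift : Bζ • xbar (t + 1) - xx = (Bζ • xbar t - xx) + Bζ • (e - α (t + 1) • v) := by
    rw [hstep]
    module
  have hinner : ∑ i, inner ℝ (g i (z (t + 1) i)) (Bζ • xbar t - xx)
      = m * inner ℝ v (Bζ • xbar t - xx) := by
    rw [hv, real_inner_smul_left, sum_inner, mul_inv_cancel_left₀ hm₀.ne']
  have hdesc := mul_le_mul_of_nonneg_left
    (inner_le_of_perturbed_step (u := Bζ • xbar t - xx) hB (hα_pos t) he_le hv_le) hm₀.le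
  rw [← hshift] at hdesc
  calc ∑ i, (f i (Bζ • xbar t) - f i xx)
      ≤ ∑ i, (inner ℝ (g i (z (t + 1) i)) (Bζ • xbar t - xx)
          + 2 * D * ‖z (t + 1) i - Bζ • xbar t‖) :=
        sum_le_sum fun i _ => (hconv i).sub_le_inner_gradient_add (hgrad i) (hD i) _ _ _
    _ = m * inner ℝ v (Bζ • xbar t - xx) + 2 * D * ∑ i, ‖z (t + 1) i - Bζ • xbar t‖ := by
        rw [sum_add_distrib, hinner, ← mul_sum]
    _ ≤ _ := add_le_add_left hdesc _
    _ = _ := by ring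
end

section
/- The sequence {x(t)} converges to some point x* ∈ X*. -/
open Finset Filter

/-- Discrete Grönwall bound for a perturbed recursion. -/
theorem le_exp_sum_mul_of_le_one_add_mul_add {u b c : ℕ → ℝ}
    (hu : ∀ t, 0 ≤ u t) (hb : ∀ t, 0 ≤ b t) (hc : ∀ t, 0 ≤ c t)
    (h : ∀ t, u (t + 1) ≤ (1 + b t) * u t + c t) (t : ℕ) :
    u t ≤ Real.exp (∑ i ∈ range t, b i) * (u 0 + ∑ i ∈ range t, c i) := by
  induction t with
  | zero => simp
  | succ t ih =>
    rw [sum_range_succ, sum_range_succ, ← add_assoc, mul_add]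
    refine (h t).trans (add_le_add ?_ ?_)
    · have hexp : 1 + b t ≤ Real.exp (b t) := by
        linarith [Real.add_one_le_exp (b t)]
      calc (1 + b t) * u t
          ≤ Real.exp (b t) *
              (Real.exp (∑ i ∈ range t, b i) * (u 0 + ∑ i ∈ range t, c i)) :=
            mul_le_mul hexp ih (hu t) (Real.exp_pos _).le
        _ = _ := by rw [Real.exp_add]; ring
    · refine le_mul_of_one_le_left (hc t) (Real.one_le_exp ?_)
      exact add_nonneg (sum_nonneg fun i _ => hb i) (hb t)

/-- Deterministic Robbins–Siegmund lemma. -/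
theorem tendsto_and_summable_of_le_one_add_mul_sub_add {u b c w : ℕ → ℝ}
    (hu : ∀ t, 0 ≤ u t) (hb : ∀ t, 0 ≤ b t) (hc : ∀ t, 0 ≤ c t) (hw : ∀ t, 0 ≤ w t)
    (hbs : Summable b) (hcs : Summable c)
    (h : ∀ t, u (t + 1) ≤ (1 + b t) * u t - w t + c t) :
    (∃ l, Tendsto u atTop (nhds l)) ∧ Summable w := by
  obtain ⟨M, hM⟩ : ∃ M, ∀ t, u t ≤ M := by
    refine ⟨Real.exp (∑' i, b i) * (u 0 + ∑' i, c i), fun t => ?_⟩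
    refine (le_exp_sum_mul_of_le_one_add_mul_add hu hb hc
      (fun t => by linarith [h t, hw t]) t).trans ?_
    refine mul_le_mul (Real.exp_le_exp.2 (hbs.sum_le_tsum _ fun i _ => hb i))
      (add_le_add le_rfl (hcs.sum_le_tsum _ fun i _ => hc i)) ?_ (Real.exp_pos _).le
    exact add_nonneg (hu 0) (sum_nonneg fun i _ => hc i)
  have hM0 : 0 ≤ M := (hu 0).trans (hM 0)
  set e : ℕ → ℝ := fun t => b t * M + c t with he
  have hes : Summable e := (hbs.mul_right M).add hcs
  have he0 : ∀ t, 0 ≤ e t := fun t => add_nonneg (mul_nonneg (hb t) hM0) (hc t)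
  have hstep : ∀ t, u (t + 1) + w t ≤ u t + e t := fun t => by
    have := mul_le_mul_of_nonneg_left (hM t) (hb t)
    simp only [he]
    linarith [h t]
  have hsum : ∀ t, ∑ i ∈ range t, e i ≤ ∑' i, e i := fun t =>
    hes.sum_le_tsum _ fun i _ => he0 i
  constructor
  · have hanti : Antitone fun t => u t - ∑ i ∈ range t, e i :=
      antitone_nat_of_succ_le fun t => by
        rw [sum_range_succ]
        linarith [hstep t, hw t]
    have hbdd : BddBelow (Set.range fun t => u t - ∑ i ∈ range t, e i) := by
      refine ⟨-∑' i, e i, ?_⟩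
      rintro _ ⟨t, rfl⟩
      linarith [hu t, hsum t]
    have hlim := (tendsto_atTop_ciInf hanti hbdd).add hes.hasSum.tendsto_sum_nat
    exact ⟨_, by simpa using hlim⟩
  · refine summable_of_sum_range_le (c := u 0 + ∑' i, e i) hw fun t => ?_
    have hind : u t + ∑ i ∈ range t, w i ≤ u 0 + ∑ i ∈ range t, e i := by
      induction t with
      | zero => simp
      | succ t ih =>
        rw [sum_range_succ, sum_range_succ]
        linarith [hstep t]
    linarith [hu t, hsum t]

/-- If `∑ a` diverges and `∑ a * g` converges, then `g` is frequently small. -/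
theorem frequently_lt_of_summable_mul_of_not_summable {a g : ℕ → ℝ}
    (ha : ∀ t, 0 ≤ a t) (has : ¬ Summable a) (hag : Summable fun t => a t * g t)
    {ε : ℝ} (hε : 0 < ε) : ∃ᶠ t in atTop, g t < ε := by
  intro hev
  refine has ((hag.mul_right ε⁻¹).of_norm_bounded_eventually_nat ?_)
  filter_upwards [hev] with t ht
  rw [Real.norm_of_nonneg (ha t), ← div_eq_mul_inv, le_div_iff₀ hε]
  exact mul_le_mul_of_nonneg_left (not_lt.1 ht) (ha t)

/-- Let `f : ℝ^d → ℝ` be continuous with nonempty set of global minimizers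
`X* = {x : f(x) = inf f}`. If `{x(t)}` satisfies, for all `x ∈ X*` and `t ≥ 0`,
`‖x(t+1) − x‖² ≤ (1 + b(t))‖x(t) − x‖² − a(t)(f(x(t)) − f(x)) + c(t)`
with `a, b, c ≥ 0`, `∑ b(t) < ∞`, `∑ a(t) = ∞`, `∑ c(t) < ∞`, then `{x(t)}`
converges to some `x* ∈ X*`. -/
theorem stmt_8
    (d : ℕ) (hd : 1 ≤ d)
    (f : EuclideanSpace ℝ (Fin d) → ℝ) (hf : Continuous f)
    (Xstar : Set (EuclideanSpace ℝ (Fin d)))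
    (hXstar : Xstar = {x | ∀ y, f x ≤ f y})
    (hne : Xstar.Nonempty)
    (x : ℕ → EuclideanSpace ℝ (Fin d))
    (a b c : ℕ → ℝ)
    (ha_nonneg : ∀ t, 0 ≤ a t) (hb_nonneg : ∀ t, 0 ≤ b t) (hc_nonneg : ∀ t, 0 ≤ c t)
    (hb_sum : Summable b) (ha_div : ¬ Summable a) (hc_sum : Summable c)
    (hrec : ∀ xs ∈ Xstar, ∀ t : ℕ,
      ‖x (t+1) - xs‖ ^ 2 ≤ (1 + b t) * ‖x t - xs‖ ^ 2 - a t * (f (x t) - f xs) + c t) :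
    ∃ xstar ∈ Xstar, Tendsto x atTop (nhds xstar) := by
  subst hXstar
  have hRS : ∀ z, (∀ y, f z ≤ f y) →
      (∃ l, Tendsto (fun t => ‖x t - z‖ ^ 2) atTop (nhds l)) ∧
        Summable fun t => a t * (f (x t) - f z) := fun z hz =>
    tendsto_and_summable_of_le_one_add_mul_sub_add (fun t => sq_nonneg _) hb_nonneg hc_nonneg
      (fun t => mul_nonneg (ha_nonneg t) (sub_nonneg.2 (hz _))) hb_sum hc_sum (hrec z hz)
  obtain ⟨z₀, hz₀⟩ := hne
  obtain ⟨⟨l₀, hl₀⟩, hsum⟩ := hRS z₀ hz₀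
  obtain ⟨R, hR⟩ := hl₀.bddAbove_range
  have hball : ∀ t, x t ∈ Metric.closedBall z₀ (√R) := fun t => by
    rw [mem_closedBall_iff_norm]
    exact Real.le_sqrt_of_sq_le (hR ⟨t, rfl⟩)
  obtain ⟨φ, hφ, hφf⟩ := extraction_forall_of_frequently fun n : ℕ =>
    frequently_lt_of_summable_mul_of_not_summable ha_nonneg ha_div hsum
      (Nat.one_div_pos_of_nat (α := ℝ) (n := n))
  obtain ⟨z, -, ψ, hψ, hz⟩ :=
    tendsto_subseq_of_bounded Metric.isBounded_closedBall fun n => hball (φ n)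
  have hfz : f z ≤ f z₀ := by
    have hgap : Tendsto (fun n => f (x (φ (ψ n))) - f z₀) atTop (nhds (f z - f z₀)) :=
      ((hf.tendsto z).comp hz).sub_const _
    have hsmall := (tendsto_one_div_add_atTop_nhds_zero_nat (𝕜 := ℝ)).comp hψ.tendsto_atTop
    exact sub_nonpos.1 (le_of_tendsto_of_tendsto' hgap hsmall fun n => (hφf (ψ n)).le)
  have hzmin : ∀ y, f z ≤ f y := fun y => hfz.trans (hz₀ y)
  refine ⟨z, hzmin, ?_⟩
  obtain ⟨⟨l, hl⟩, -⟩ := hRS z hzmin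
  have hl_sub := hl.comp (hφ.comp hψ).tendsto_atTop
  have hzero : Tendsto (fun n => ‖x (φ (ψ n)) - z‖ ^ 2) atTop (nhds 0) := by
    simpa using (tendsto_iff_norm_sub_tendsto_zero.1 hz).pow 2
  obtain rfl : l = 0 := tendsto_nhds_unique hl_sub hzero
  rw [tendsto_iff_norm_sub_tendsto_zero]
  simpa using hl.sqrt
end

section
/- Assume each f_i is convex, that ζ is non-increasing with ∑_{t=1}^∞ ζ(t) < 1 (so that B_ζ > 0), and that α(t+1) > 0. Then for every t ≥ 0 and every x ∈ ℝ^d: ‖B_ζ x̄(t+1) − x‖² ≤ (1 + τ(t))‖B_ζ x̄(t) − x‖² − (2α(t+1)B_ζ/m)(f(B_ζ x̄(t)) − f(x)) + c(t) + d(t), where f = ∑_{i=1}^m f_i, c(t) = B_ζ²(2α(t+1)²D² + 2τ(t)² + τ(t)), and d(t) = (4α(t+1)D B_ζ/m) ∑_{i=1}^m ‖ẑ_i(t+1) − B_ζ x̄(t)‖. -/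
open Finset Filter

/-- Gradients of a convex function taken at a point `c` other than the base point `u` still give a
descent inequality, up to an error proportional to `‖c - u‖`. -/
lemma ConvexOn.neg_inner_gradient_le {E : Type*} [NormedAddCommGroup E] [InnerProductSpace ℝ E]
    [CompleteSpace E] {f : E → ℝ} {v v' u c : E} {D : ℝ} (hf : ConvexOn ℝ Set.univ f)
    (hv : HasGradientAt f v c) (hv' : HasGradientAt f v' u) (hD : ‖v‖ ≤ D) (hD' : ‖v'‖ ≤ D)
    (b : E) : -inner ℝ (u - b) v ≤ f b - f u + 2 * D * ‖c - u‖ := by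
  have h1 := hf.inner_gradient_le_sub hv b
  have h2 := hf.inner_gradient_le_sub hv' c
  have h3 : inner ℝ v (c - u) ≤ D * ‖c - u‖ :=
    (real_inner_le_norm _ _).trans (by gcongr)
  have h4 : -inner ℝ v' (c - u) ≤ D * ‖c - u‖ := by
    rw [← inner_neg_left]
    exact (real_inner_le_norm _ _).trans (by rw [norm_neg]; gcongr)
  have h5 : -inner ℝ (u - b) v = inner ℝ v (b - c) + inner ℝ v (c - u) := by
    rw [← inner_add_right, ← inner_neg_left, real_inner_comm]
    congr 1
    abel
  linarith

/-- One step of a perturbed gradient method with perturbation `e` and averaged gradient `h`. -/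
lemma norm_add_smul_sub_sq_le {E : Type*} [NormedAddCommGroup E] [InnerProductSpace ℝ E]
    {u e h : E} {B α τ D : ℝ} (hB : 0 ≤ B) (hτ : 0 ≤ τ) (he : ‖e‖ ≤ τ) (hh : ‖h‖ ≤ D) :
    ‖u + B • (e - α • h)‖ ^ 2 ≤ (1 + τ) * ‖u‖ ^ 2 - 2 * α * B * inner ℝ u h
      + B ^ 2 * (2 * α ^ 2 * D ^ 2 + 2 * τ ^ 2 + τ) := by
  have h1 : ‖e - α • h‖ ^ 2 ≤ 2 * α ^ 2 * D ^ 2 + 2 * τ ^ 2 := by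
    have hp := parallelogram_law_with_norm ℝ e (α • h)
    have h2 : ‖α • h‖ ^ 2 ≤ α ^ 2 * D ^ 2 := by
      rw [norm_smul, mul_pow, Real.norm_eq_abs, sq_abs]
      gcongr
    have h3 : ‖e‖ ^ 2 ≤ τ ^ 2 := by gcongr
    nlinarith [sq_nonneg ‖e + α • h‖]
  have h2 : 2 * B * inner ℝ u e ≤ τ * ‖u‖ ^ 2 + B ^ 2 * τ := by
    have h3 : inner ℝ u e ≤ ‖u‖ * τ := (real_inner_le_norm _ _).trans (by gcongr)
    nlinarith [mul_le_mul_of_nonneg_left h3 hB, mul_nonneg hτ (sq_nonneg (‖u‖ - B))]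
  have h4 := mul_le_mul_of_nonneg_left h1 (sq_nonneg B)
  rw [norm_add_sq_real, norm_smul, mul_pow, Real.norm_eq_abs, sq_abs, inner_smul_right,
    inner_sub_right, inner_smul_right]
  linarith

/-- The average of finitely many vectors of norm at most `C` has norm at most `C`. -/
lemma norm_inv_smul_sum_le {E : Type*} [NormedAddCommGroup E] [NormedSpace ℝ E] {m : ℕ}
    (hm : 1 ≤ m) {v : Fin m → E} {C : ℝ} (hv : ∀ i, ‖v i‖ ≤ C) :
    ‖(m : ℝ)⁻¹ • ∑ i, v i‖ ≤ C := by
  have hm' : (0 : ℝ) < m := by exact_mod_cast hm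
  have h : ‖∑ i, v i‖ ≤ m * C := by
    simpa using norm_sum_le_of_le univ fun i _ => hv i
  rw [norm_smul, norm_inv, Real.norm_natCast, inv_mul_le_iff₀ hm']
  exact h

/-- Accumulated errors with summable bound of total mass at most one cannot exhaust mass `m`. -/
lemma nonneg_add_tsum_sum {m : ℕ} {θ : ℕ → Fin m → ℝ} {ζ : ℕ → ℝ} (hθ : ∀ s j, |θ s j| ≤ ζ s)
    (hζ : Summable ζ) (hζ1 : ∑' s, ζ s ≤ 1) : 0 ≤ m + ∑' s, ∑ j, θ s j := by
  have hbound : ∀ s, ‖∑ j, θ s j‖ ≤ m * ζ s := fun s => by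
    simpa using norm_sum_le_of_le univ fun j _ => (Real.norm_eq_abs _).trans_le (hθ s j)
  have h := tsum_of_norm_bounded (hζ.hasSum.mul_left (m : ℝ)) hbound
  have hm : (m : ℝ) * ∑' s, ζ s ≤ m := mul_le_of_le_one_right (Nat.cast_nonneg m) hζ1
  linarith [neg_le_of_abs_le h]

/-- Corollary `main`: in the event-triggered gradient-push algorithm, if each
`f_i` is convex, `ζ` is non-increasing with `∑_{t≥1} ζ(t) < 1` (so `B_ζ > 0`) and
`α(t+1) > 0`, then for every `t ≥ 0` and `x ∈ ℝ^d`: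
`‖B_ζ x̄(t+1) − x‖² ≤ (1 + τ(t))‖B_ζ x̄(t) − x‖² − (2α(t+1)B_ζ/m)(f(B_ζ x̄(t)) − f(x))
 + c(t) + d(t)`, where `f = ∑_i f_i`, `c(t) = B_ζ²(2α(t+1)²D² + 2τ(t)² + τ(t))` and
`d(t) = (4α(t+1)D B_ζ/m) ∑_i ‖ẑ_i(t+1) − B_ζ x̄(t)‖`. -/
theorem stmt_9
    (m d : ℕ) (hm : 1 ≤ m) (hd : 1 ≤ d)
    (A : ℕ → Matrix (Fin m) (Fin m) ℝ)
    (hA_nonneg : ∀ t i j, 0 ≤ A t i j)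
    (hA_col : ∀ t j, ∑ i, A t i j = 1)
    (α τ ζ : ℕ → ℝ)
    (hα_nonneg : ∀ t, 0 ≤ α t) (hτ_nonneg : ∀ t, 0 ≤ τ t) (hζ_nonneg : ∀ t, 0 ≤ ζ t)
    (D : ℝ)
    (f : Fin m → EuclideanSpace ℝ (Fin d) → ℝ)
    (g : Fin m → EuclideanSpace ℝ (Fin d) → EuclideanSpace ℝ (Fin d))
    (hgrad : ∀ i x, HasGradientAt (f i) (g i x) x)
    (hD : ∀ i x, ‖g i x‖ ≤ D)
    (x xh w z : ℕ → Fin m → EuclideanSpace ℝ (Fin d))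
    (y yh : ℕ → Fin m → ℝ)
    (hxh0 : ∀ i, xh 0 i = x 0 i)
    (hy0 : ∀ i, y 0 i = 1) (hyh0 : ∀ i, yh 0 i = 1)
    (hw : ∀ t i, w (t + 1) i = ∑ j, A t i j • xh t j)
    (hy : ∀ t i, y (t + 1) i = ∑ j, A t i j * yh t j)
    (hz : ∀ t i, z (t + 1) i = (y (t + 1) i)⁻¹ • w (t + 1) i)
    (hx : ∀ t i, x (t + 1) i = w (t + 1) i - α (t + 1) • g i (z (t + 1) i))
    (hxh_choice : ∀ t i, xh (t + 1) i = x (t + 1) i ∨ xh (t + 1) i = xh t i)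
    (hxh_err : ∀ t i, ‖xh (t + 1) i - x (t + 1) i‖ ≤ τ (t + 1))
    (hyh_choice : ∀ t i, yh (t + 1) i = y (t + 1) i ∨ yh (t + 1) i = yh t i)
    (hyh_err : ∀ t i, |yh (t + 1) i - y (t + 1) i| ≤ ζ (t + 1))
    (hypos : ∀ t i, 0 < y t i)
    (mζ : ℝ) (hmζ : mζ = m + ∑' s : ℕ, ∑ j, (yh (s + 1) j - y (s + 1) j))
    (Bζ : ℝ) (hBζ : Bζ = mζ / m)
    (xbar : ℕ → EuclideanSpace ℝ (Fin d))
    (hxbar : ∀ t, xbar t = (m : ℝ)⁻¹ • ∑ i, x t i)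
    (hconv : ∀ i, ConvexOn ℝ Set.univ (f i))
    (hζ_mono : Antitone ζ)
    (hζ_sum : Summable (fun s : ℕ => ζ (s + 1)))
    (hζ1 : ∑' s : ℕ, ζ (s + 1) < 1)
    (hα_pos : ∀ t : ℕ, 0 < α (t + 1)) :
    ∀ t : ℕ, ∀ xx : EuclideanSpace ℝ (Fin d),
      ‖Bζ • xbar (t + 1) - xx‖ ^ 2 ≤
        (1 + τ t) * ‖Bζ • xbar t - xx‖ ^ 2
          - (2 * α (t + 1) * Bζ / m) * ((∑ i, f i (Bζ • xbar t)) - ∑ i, f i xx)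
          + Bζ ^ 2 * (2 * α (t + 1) ^ 2 * D ^ 2 + 2 * τ t ^ 2 + τ t)
          + (4 * α (t + 1) * D * Bζ / m) * ∑ i, ‖z (t + 1) i - Bζ • xbar t‖ := by
  intro t xx
  have hB : 0 ≤ Bζ := by
    rw [hBζ, hmζ]
    exact div_nonneg (nonneg_add_tsum_sum (fun s j => hyh_err s j) hζ_sum hζ1.le)
      (Nat.cast_nonneg m)
  have herr : ∀ i, ‖xh t i - x t i‖ ≤ τ t := fun i => by
    cases t with
    | zero => simpa [hxh0] using hτ_nonneg 0
    | succ k => exact hxh_err k i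
  set e := (m : ℝ)⁻¹ • ∑ i, (xh t i - x t i) with he
  set h := (m : ℝ)⁻¹ • ∑ i, g i (z (t + 1) i) with hh
  have hsum : ∑ i, w (t + 1) i = ∑ i, xh t i := by
    simp_rw [hw]
    rw [sum_comm]
    simp_rw [← sum_smul, hA_col, one_smul]
  have hstep : Bζ • xbar (t + 1) - xx = (Bζ • xbar t - xx) + Bζ • (e - α (t + 1) • h) := by
    have hx' : xbar (t + 1) = xbar t + (e - α (t + 1) • h) := by
      rw [hxbar, hxbar, he, hh]
      simp_rw [hx]
      rw [sum_sub_distrib, sum_sub_distrib, hsum, ← smul_sum]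
      module
    rw [hx']
    module
  have hmain := norm_add_smul_sub_sq_le (u := Bζ • xbar t - xx) (α := α (t + 1)) hB
    (hτ_nonneg t) (norm_inv_smul_sum_le hm herr : ‖e‖ ≤ τ t)
    (norm_inv_smul_sum_le hm fun i => hD i (z (t + 1) i) : ‖h‖ ≤ D)
  have hinner : -∑ i, inner ℝ (Bζ • xbar t - xx) (g i (z (t + 1) i)) ≤
      ∑ i, f i xx - ∑ i, f i (Bζ • xbar t) + 2 * D * ∑ i, ‖z (t + 1) i - Bζ • xbar t‖ := by
    rw [← sum_neg_distrib, mul_sum, ← sum_sub_distrib, ← sum_add_distrib]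
    exact sum_le_sum fun i _ => (hconv i).neg_inner_gradient_le (hgrad i _) (hgrad i _)
      (hD i _) (hD i _) xx
  have hcoef : 0 ≤ 2 * α (t + 1) * Bζ / m := by
    have := hα_nonneg (t + 1)
    positivity
  have hscaled := mul_le_mul_of_nonneg_left hinner hcoef
  rw [hstep]
  refine hmain.trans ?_
  rw [inner_smul_right, inner_sum]
  rw [← sub_nonneg] at hscaled ⊢
  refine hscaled.trans_eq ?_
  ring
end

section
/- ∑_{t=1}^∞ α(t+1)[K(t) + ∑_{s=0}^{t−1} K(t)(α(s+1) + τ(s))] < ∞. -/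
open Finset Filter

/-- An antitone sequence with summable squares is `O(1 / √t)`. -/
theorem exists_mul_sqrt_le_of_antitone {α : ℕ → ℝ} (hα_nonneg : ∀ t, 0 ≤ α t)
    (hα : Antitone α) (hsum : Summable (fun t : ℕ => α (t + 1) ^ 2)) :
    ∃ C, ∀ t : ℕ, α (t + 1) * √((t : ℝ) + 1) ≤ C := by
  refine ⟨√(∑' t, α (t + 1) ^ 2), fun t => Real.le_sqrt_of_sq_le ?_⟩
  have hle : ∑ _s ∈ Finset.range (t + 1), α (t + 1) ^ 2
      ≤ ∑ s ∈ Finset.range (t + 1), α (s + 1) ^ 2 :=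
    Finset.sum_le_sum fun s hs => pow_le_pow_left₀ (hα_nonneg _)
      (hα (by have := Finset.mem_range.1 hs; lia)) 2
  rw [Finset.sum_const, Finset.card_range, nsmul_eq_mul] at hle
  push_cast at hle
  rw [mul_pow, Real.sq_sqrt (by positivity), mul_comm]
  exact hle.trans (hsum.sum_le_tsum _ fun s _ => sq_nonneg _)

theorem sum_range_one_div_sqrt_le (t : ℕ) :
    ∑ s ∈ Finset.range t, 1 / √((s : ℝ) + 1) ≤ 2 * √(t : ℝ) := by
  induction t with
  | zero => simp
  | succ t ih =>
    rw [Finset.sum_range_succ]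
    push_cast
    have hpos : 0 < √((t : ℝ) + 1) := by positivity
    have hsq : √((t : ℝ) + 1) ^ 2 = t + 1 := Real.sq_sqrt (by positivity)
    have hsq' : √(t : ℝ) ^ 2 = t := Real.sq_sqrt (by positivity)
    have hstep : 1 / √((t : ℝ) + 1) ≤ 2 * √((t : ℝ) + 1) - 2 * √(t : ℝ) := by
      rw [div_le_iff₀ hpos]
      nlinarith [sq_nonneg (√((t : ℝ) + 1) - √(t : ℝ))]
    linarith

/-- The weighted series converges as soon as `α (t + 1) = O(1 / √(t + 1))`. -/
theorem summable_of_mul_sqrt_le {K τ α : ℕ → ℝ}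
    (hK_nonneg : ∀ t, 0 ≤ K t) (hτ_nonneg : ∀ t, 0 ≤ τ t) (hα_nonneg : ∀ t, 0 ≤ α t)
    (hK : Tendsto (fun t : ℕ => (t : ℝ) ^ (3/2 : ℝ) * K t) atTop (nhds 0))
    (hτ : Summable τ) {C : ℝ} (hC : ∀ t : ℕ, α (t + 1) * √((t : ℝ) + 1) ≤ C) :
    Summable (fun t : ℕ =>
      α (t + 1) * (K t + ∑ s ∈ Finset.range t, K t * (α (s + 1) + τ s))) := by
  have hC0 : 0 ≤ C := (mul_nonneg (hα_nonneg _) (Real.sqrt_nonneg _)).trans (hC 0)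
  have hT0 : 0 ≤ ∑' s, τ s := tsum_nonneg hτ_nonneg
  set D : ℝ := 1 + C * 2 + ∑' s, τ s with hD
  have hD0 : 0 ≤ D := by positivity
  have hsum : Summable (fun t : ℕ => C * D * (1 / (t : ℝ) ^ (3/2 : ℝ))) :=
    (Real.summable_one_div_nat_rpow.2 (by norm_num)).mul_left _
  refine hsum.of_norm_bounded_eventually_nat ?_
  filter_upwards [hK.eventually_le_const zero_lt_one, eventually_ge_atTop 1] with t hKt ht
  have ht' : (1 : ℝ) ≤ t := by exact_mod_cast ht
  have hsqrt : 1 ≤ √(t : ℝ) := Real.one_le_sqrt.2 ht'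
  have hKle : K t ≤ 1 / (t : ℝ) ^ (3/2 : ℝ) := by
    rwa [le_div_iff₀' (by positivity)]
  have hαsum : ∑ s ∈ Finset.range t, α (s + 1) ≤ C * (2 * √(t : ℝ)) := by
    refine le_trans ?_ (mul_le_mul_of_nonneg_left (sum_range_one_div_sqrt_le t) hC0)
    rw [Finset.mul_sum]
    refine Finset.sum_le_sum fun s _ => ?_
    rw [mul_one_div, le_div_iff₀ (by positivity)]
    exact hC s
  have hτsum : ∑ s ∈ Finset.range t, τ s ≤ ∑' s, τ s :=
    hτ.sum_le_tsum _ fun s _ => hτ_nonneg s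
  have hbracket : 1 + ∑ s ∈ Finset.range t, (α (s + 1) + τ s) ≤ D * √(t : ℝ) := by
    rw [Finset.sum_add_distrib, hD]
    nlinarith
  have hαt : α (t + 1) * √(t : ℝ) ≤ C :=
    (mul_le_mul_of_nonneg_left (Real.sqrt_le_sqrt (by linarith)) (hα_nonneg _)).trans (hC t)
  have hnonneg : 0 ≤ ∑ s ∈ Finset.range t, (α (s + 1) + τ s) :=
    Finset.sum_nonneg fun s _ => add_nonneg (hα_nonneg _) (hτ_nonneg _)
  have hα0 := hα_nonneg (t + 1)
  have hK0 := hK_nonneg t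
  rw [← Finset.mul_sum, Real.norm_of_nonneg (by positivity)]
  calc α (t + 1) * (K t + K t * ∑ s ∈ Finset.range t, (α (s + 1) + τ s))
      = α (t + 1) * (1 + ∑ s ∈ Finset.range t, (α (s + 1) + τ s)) * K t := by ring
    _ ≤ α (t + 1) * (D * √(t : ℝ)) * K t := by gcongr
    _ = α (t + 1) * √(t : ℝ) * D * K t := by ring
    _ ≤ C * D * (1 / (t : ℝ) ^ (3/2 : ℝ)) := by gcongr

/-- Let `K, τ, α : ℕ → [0,∞)` with `lim_{t→∞} t^{3/2} K(t) = 0`,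
`∑_{t=0}^∞ τ(t) < ∞`, and either `α` non-increasing with `∑_{t=0}^∞ α(t+1)² < ∞`,
or `α(t) = 1/√t` for all `t ≥ 1`. Then
`∑_{t=1}^∞ α(t+1)[K(t) + ∑_{s=0}^{t−1} K(t)(α(s+1) + τ(s))] < ∞`.
(The `t = 0` term is finite, so summability over all `t : ℕ` is equivalent to the
convergence of the series starting at `t = 1`.) -/
theorem stmt_11
    (K τ α : ℕ → ℝ)
    (hK_nonneg : ∀ t, 0 ≤ K t) (hτ_nonneg : ∀ t, 0 ≤ τ t) (hα_nonneg : ∀ t, 0 ≤ α t)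
    (hK : Tendsto (fun t : ℕ => (t : ℝ) ^ (3/2 : ℝ) * K t) atTop (nhds 0))
    (hτ : Summable τ)
    (hα : (Antitone α ∧ Summable (fun t : ℕ => α (t + 1) ^ 2)) ∨
      (∀ t : ℕ, 1 ≤ t → α t = 1 / Real.sqrt t)) :
    Summable (fun t : ℕ =>
      α (t + 1) * (K t + ∑ s ∈ Finset.range t, K t * (α (s + 1) + τ s))) := by
  obtain ⟨C, hC⟩ : ∃ C, ∀ t : ℕ, α (t + 1) * √((t : ℝ) + 1) ≤ C := by
    rcases hα with ⟨hanti, hsum⟩ | hα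
    · exact exists_mul_sqrt_le_of_antitone hα_nonneg hanti hsum
    · refine ⟨1, fun t => ?_⟩
      rw [hα (t + 1) (by lia)]
      push_cast
      exact (one_div_mul_cancel (by positivity)).le
  exact summable_of_mul_sqrt_le hK_nonneg hτ_nonneg hα_nonneg hK hτ hC
end

section
/- Assume Q := inf_{t≥0} min_{1≤i≤m} [A(t:0)1_m]_i > 0; that each f_i is convex; that α is non-increasing with ∑_{t=0}^∞ α(t+1) = ∞ and ∑_{t=0}^∞ α(t+1)² < ∞; that τ is non-increasing with ∑_{t=1}^∞ τ(t) < ∞; that ζ is non-increasing with ∑_{t=1}^∞ t^{3/2}ζ(t) < ∞ and ∑_{t=1}^∞ ζ(t) < 1; and that the set X* of global minimizers of f = ∑_{i=1}^m f_i is nonempty. Then there exists x* ∈ X* such that for every i ∈ {1,…,m}, lim_{t→∞} ẑ_i(t) = x*. -/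
open Finset Filter

/-- The geometrically discounted sum `∑_{s ≤ t} l ^ (t - s) * a s`. -/
noncomputable def discountedSum (l : ℝ) (a : ℕ → ℝ) (t : ℕ) : ℝ :=
  ∑ s ∈ range (t + 1), l ^ (t - s) * a s

section DiscountedSum

variable {l : ℝ} {a b : ℕ → ℝ}

theorem discountedSum_nonneg (hl : 0 ≤ l) (ha : ∀ t, 0 ≤ a t) (t : ℕ) :
    0 ≤ discountedSum l a t :=
  sum_nonneg fun s _ => mul_nonneg (pow_nonneg hl _) (ha s)

theorem discountedSum_add_mul (k : ℝ) (t : ℕ) :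
    discountedSum l (fun s => a s + k * b s) t =
      discountedSum l a t + k * discountedSum l b t := by
  simp only [discountedSum, mul_sum, ← sum_add_distrib]
  exact sum_congr rfl fun s _ => by ring

theorem summable_sum_mul_antidiagonal_of_nonneg (ha : ∀ t, 0 ≤ a t) (hb : ∀ t, 0 ≤ b t)
    (has : Summable a) (hbs : Summable b) :
    Summable fun t => ∑ ij ∈ antidiagonal t, a ij.1 * b ij.2 :=
  summable_sum_mul_antidiagonal_of_summable_mul (has.mul_of_nonneg hbs ha hb)

theorem summable_discountedSum (hl : 0 ≤ l) (hl1 : l < 1) (ha : ∀ t, 0 ≤ a t)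
    (hs : Summable a) : Summable (discountedSum l a) := by
  have hg := summable_geometric_of_lt_one hl hl1
  have h := summable_sum_mul_antidiagonal_of_nonneg ha (fun n => pow_nonneg hl n) hs hg
  refine h.congr fun t => ?_
  rw [Nat.sum_antidiagonal_eq_sum_range_succ fun i j => a i * l ^ j]
  exact sum_congr rfl fun s _ => mul_comm _ _

theorem summable_succ_mul_discountedSum (hl : 0 ≤ l) (hl1 : l < 1) (ha : ∀ t, 0 ≤ a t)
    (hs : Summable fun t : ℕ => ((t : ℝ) + 1) * a t) :
    Summable fun t : ℕ => ((t : ℝ) + 1) * discountedSum l a t := by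
  have hg : Summable fun n : ℕ => ((n : ℝ) + 1) * l ^ n := by
    have hn : ‖l‖ < 1 := by rwa [Real.norm_of_nonneg hl]
    have h1 : Summable fun n : ℕ => (n : ℝ) ^ 1 * l ^ n :=
      summable_pow_mul_geometric_of_norm_lt_one 1 hn
    exact (h1.add (summable_geometric_of_lt_one hl hl1)).congr fun n => by ring
  have ha' : ∀ t : ℕ, 0 ≤ ((t : ℝ) + 1) * a t := fun t => mul_nonneg (by positivity) (ha t)
  have hg0 : ∀ n : ℕ, 0 ≤ ((n : ℝ) + 1) * l ^ n := fun n =>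
    mul_nonneg (by positivity) (pow_nonneg hl n)
  have h := summable_sum_mul_antidiagonal_of_nonneg ha' hg0 hs hg
  have hle : ∀ t : ℕ, ((t : ℝ) + 1) * discountedSum l a t ≤ ∑ ij ∈ antidiagonal t,
      (((ij.1 : ℝ) + 1) * a ij.1) * (((ij.2 : ℝ) + 1) * l ^ ij.2) := by
    intro t
    rw [Nat.sum_antidiagonal_eq_sum_range_succ
      fun i j => (((i : ℝ) + 1) * a i) * (((j : ℝ) + 1) * l ^ j), discountedSum, mul_sum]
    refine sum_le_sum fun s hs => ?_
    have hst : s ≤ t := Nat.lt_succ_iff.1 (mem_range.1 hs)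
    have hst' : (s : ℝ) ≤ t := by exact_mod_cast hst
    have hp : 0 ≤ l ^ (t - s) * a s := mul_nonneg (pow_nonneg hl _) (ha s)
    have hw : (t : ℝ) + 1 ≤ (s + 1) * ((t - s) + 1) := by
      nlinarith [mul_nonneg (Nat.cast_nonneg (α := ℝ) s) (sub_nonneg.2 hst')]
    rw [Nat.cast_sub hst]
    calc ((t : ℝ) + 1) * (l ^ (t - s) * a s)
        ≤ ((s + 1) * ((t - s) + 1)) * (l ^ (t - s) * a s) := mul_le_mul_of_nonneg_right hw hp
      _ = _ := by ring
  exact Summable.of_nonneg_of_le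
    (fun t => mul_nonneg (by positivity) (discountedSum_nonneg hl ha t)) hle h

theorem tendsto_discountedSum_of_summable_sq (hl : 0 ≤ l) (hl1 : l < 1)
    (hs : Summable fun t => a t ^ 2) : Tendsto (discountedSum l a) atTop (nhds 0) := by
  have hgeo : ∀ t : ℕ, ∑ s ∈ range (t + 1), l ^ (t - s) ≤ (1 - l)⁻¹ := fun t => by
    have := sum_range_reflect (fun i => l ^ i) (t + 1)
    simp only [Nat.add_sub_cancel] at this
    rw [this, ← tsum_geometric_of_lt_one hl hl1]
    exact (summable_geometric_of_lt_one hl hl1).sum_le_tsum _ fun i _ => pow_nonneg hl i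
  have hsq : ∀ t, discountedSum l a t ^ 2 ≤
      (1 - l)⁻¹ * discountedSum l (fun s => a s ^ 2) t := fun t => by
    refine (sum_sq_le_sum_mul_sum_of_sq_le_mul (range (t + 1))
      (r := fun s => l ^ (t - s) * a s) (f := fun s => l ^ (t - s))
      (g := fun s => l ^ (t - s) * a s ^ 2) (fun s _ => pow_nonneg hl _)
      (fun s _ => mul_nonneg (pow_nonneg hl _) (sq_nonneg _)) (fun s _ => by ring_nf; rfl)).trans ?_
    exact mul_le_mul_of_nonneg_right (hgeo t)
      (discountedSum_nonneg hl (fun s => sq_nonneg (a s)) t)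
  have h0 := (summable_discountedSum hl hl1 (fun t => sq_nonneg (a t)) hs).tendsto_atTop_zero
  have h1 : Tendsto (fun t => discountedSum l a t ^ 2) atTop (nhds 0) :=
    squeeze_zero (fun t => sq_nonneg _) hsq (by simpa using h0.const_mul (1 - l)⁻¹)
  have h2 := h1.sqrt
  simp only [Real.sqrt_sq_eq_abs, Real.sqrt_zero] at h2
  exact (tendsto_zero_iff_abs_tendsto_zero _).2 h2

theorem summable_mul_discountedSum_self (hl : 0 ≤ l) (hl1 : l < 1) (ha : ∀ t, 0 ≤ a t)
    (hmono : Antitone a) (hs : Summable fun t => a t ^ 2) :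
    Summable fun t => a (t + 1) * discountedSum l a t := by
  refine (summable_discountedSum hl hl1 (fun t => sq_nonneg (a t)) hs).of_nonneg_of_le
    (fun t => mul_nonneg (ha _) (discountedSum_nonneg hl ha t)) fun t => ?_
  rw [discountedSum, mul_sum]
  refine sum_le_sum fun s hs => ?_
  have hst : s ≤ t + 1 := (mem_range.1 hs).le
  calc a (t + 1) * (l ^ (t - s) * a s) ≤ a s * (l ^ (t - s) * a s) :=
        mul_le_mul_of_nonneg_right (hmono hst) (mul_nonneg (pow_nonneg hl _) (ha s))
    _ = _ := by ring

end DiscountedSum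

/-- A deterministic Robbins–Siegmund lemma. -/
theorem summable_and_tendsto_of_le_one_add_mul {b c ρ κ : ℕ → ℝ} (hb : ∀ t, 0 ≤ b t)
    (hc : ∀ t, 0 ≤ c t) (hρ : ∀ t, 0 ≤ ρ t) (hκ : ∀ t, 0 ≤ κ t) (hρs : Summable ρ)
    (hκs : Summable κ) (h : ∀ t, b (t + 1) ≤ (1 + ρ t) * b t - c t + κ t) :
    Summable c ∧ ∃ l, Tendsto b atTop (nhds l) := by
  have hgrow : ∀ t, b t ≤ Real.exp (∑ s ∈ range t, ρ s) * (b 0 + ∑ s ∈ range t, κ s) := by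
    intro t
    induction t with
    | zero => simp
    | succ t ih =>
      rw [sum_range_succ, sum_range_succ, Real.exp_add]
      have h1 : 1 + ρ t ≤ Real.exp (ρ t) := by linarith [Real.add_one_le_exp (ρ t)]
      have h2 : 0 ≤ ∑ s ∈ range t, ρ s := sum_nonneg fun s _ => hρ s
      have h3 : 1 ≤ Real.exp (∑ s ∈ range t, ρ s) := Real.one_le_exp h2
      have h4 : 1 ≤ Real.exp (ρ t) := Real.one_le_exp (hρ t)
      calc b (t + 1) ≤ (1 + ρ t) * b t + κ t := by linarith [h t, hc t]
        _ ≤ Real.exp (ρ t) *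
              (Real.exp (∑ s ∈ range t, ρ s) * (b 0 + ∑ s ∈ range t, κ s)) +
            Real.exp (∑ s ∈ range t, ρ s) * Real.exp (ρ t) * κ t :=
          add_le_add (mul_le_mul h1 ih (hb t) (by positivity))
            (le_mul_of_one_le_left (hκ t) (one_le_mul_of_one_le_of_one_le h3 h4))
        _ = _ := by ring
  set B := Real.exp (∑' s, ρ s) * (b 0 + ∑' s, κ s)
  have hB : ∀ t, b t ≤ B := fun t => (hgrow t).trans <|
    mul_le_mul (Real.exp_le_exp.2 (hρs.sum_le_tsum _ fun s _ => hρ s))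
      (by linarith [hκs.sum_le_tsum (range t) fun s _ => hκ s])
      (add_nonneg (hb 0) (sum_nonneg fun s _ => hκ s)) (Real.exp_pos _).le
  have hes : Summable fun t => ρ t * B + κ t := (hρs.mul_right B).add hκs
  have hB0 : 0 ≤ B := (hb 0).trans (hB 0)
  have he0 : ∀ t, 0 ≤ ρ t * B + κ t := fun t => add_nonneg (mul_nonneg (hρ t) hB0) (hκ t)
  have hstep : ∀ t, b (t + 1) ≤ b t - c t + (ρ t * B + κ t) := fun t => by
    nlinarith [h t, mul_le_mul_of_nonneg_left (hB t) (hρ t)]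
  constructor
  · refine summable_of_sum_range_le (c := b 0 + ∑' t, (ρ t * B + κ t)) hc fun n => ?_
    have hn : ∑ s ∈ range n, c s ≤ b 0 - b n + ∑ s ∈ range n, (ρ s * B + κ s) := by
      induction n with
      | zero => simp
      | succ n ih => rw [sum_range_succ, sum_range_succ]; linarith [hstep n]
    linarith [hb n, hes.sum_le_tsum (range n) fun s _ => he0 s]
  · have hanti : Antitone fun t => b t - ∑ s ∈ range t, (ρ s * B + κ s) :=
      antitone_nat_of_succ_le fun t => by
        simp only [sum_range_succ]; linarith [hstep t, hc t]
    have hbdd : BddBelow (Set.range fun t => b t - ∑ s ∈ range t, (ρ s * B + κ s)) := by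
      refine ⟨-∑' t, (ρ t * B + κ t), ?_⟩
      rintro _ ⟨t, rfl⟩
      have := hes.sum_le_tsum (range t) fun s _ => he0 s
      simp only
      linarith [hb t]
    have := (tendsto_atTop_ciInf hanti hbdd).add hes.hasSum.tendsto_sum_nat
    simp only [sub_add_cancel] at this
    exact ⟨_, this⟩

/-- A sequence that is quasi-Fejér monotone with respect to the minimizers of a continuous
function, with a non-summable decrease rate, converges to a minimizer. -/
theorem exists_tendsto_minimizer_of_quasiFejer {E : Type*} [NormedAddCommGroup E]
    [ProperSpace E] {F : E → ℝ} (hF : Continuous F) {v : ℕ → E} {β : ℕ → ℝ}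
    (hβ0 : ∀ t, 0 ≤ β t) (hβ : ¬ Summable β) (hne : ∃ p, ∀ q, F p ≤ F q)
    (h : ∀ p, (∀ q, F p ≤ F q) → ∃ ρ κ : ℕ → ℝ, (∀ t, 0 ≤ ρ t) ∧ (∀ t, 0 ≤ κ t) ∧
      Summable ρ ∧ Summable κ ∧ ∀ t, ‖v (t + 1) - p‖ ^ 2 ≤
        (1 + ρ t) * ‖v t - p‖ ^ 2 - β t * (F (v t) - F p) + κ t) :
    ∃ p, (∀ q, F p ≤ F q) ∧ Tendsto v atTop (nhds p) := by
  have key : ∀ p, (∀ q, F p ≤ F q) → Summable (fun t => β t * (F (v t) - F p)) ∧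
      ∃ l, Tendsto (fun t => ‖v t - p‖ ^ 2) atTop (nhds l) := fun p hp => by
    obtain ⟨ρ, κ, hρ, hκ, hρs, hκs, hle⟩ := h p hp
    exact summable_and_tendsto_of_le_one_add_mul (fun t => sq_nonneg _)
      (fun t => mul_nonneg (hβ0 t) (sub_nonneg.2 (hp _))) hρ hκ hρs hκs hle
  obtain ⟨p₀, hp₀⟩ := hne
  obtain ⟨hsum, l₀, hl₀⟩ := key p₀ hp₀
  have hfreq : ∀ n : ℕ, ∃ᶠ t in atTop, F (v t) - F p₀ < 1 / ((n : ℝ) + 1) := by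
    intro n hn
    have hε : 0 < 1 / ((n : ℝ) + 1) := by positivity
    refine hβ (summable_of_isBigO_nat hsum (Asymptotics.IsBigO.of_bound ((n : ℝ) + 1) ?_))
    filter_upwards [hn] with t ht
    have ht' : 1 / ((n : ℝ) + 1) ≤ F (v t) - F p₀ := not_lt.1 ht
    rw [Real.norm_of_nonneg (hβ0 t),
      Real.norm_of_nonneg (mul_nonneg (hβ0 t) (sub_nonneg.2 (hp₀ _)))]
    rw [div_le_iff₀ (by positivity)] at ht'
    nlinarith [mul_le_mul_of_nonneg_left ht' (hβ0 t)]
  obtain ⟨ψ, hψ, hψlt⟩ := extraction_forall_of_frequently hfreq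
  obtain ⟨M, hM⟩ := hl₀.bddAbove_range
  have hbdd : ∀ n, v (ψ n) ∈ Metric.closedBall p₀ (M + 1) := fun n => by
    have hMn : ‖v (ψ n) - p₀‖ ^ 2 ≤ M := hM ⟨ψ n, rfl⟩
    rw [mem_closedBall_iff_norm]
    nlinarith [sq_nonneg (‖v (ψ n) - p₀‖ - 1), norm_nonneg (v (ψ n) - p₀)]
  obtain ⟨p, -, χ, hχ, hlim⟩ := tendsto_subseq_of_bounded Metric.isBounded_closedBall hbdd
  have hFlim : Tendsto (fun n => F (v (ψ (χ n)))) atTop (nhds (F p)) :=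
    (hF.tendsto p).comp hlim
  have hFp : F p ≤ F p₀ := by
    have h1 : Tendsto (fun n : ℕ => F p₀ + 1 / ((n : ℝ) + 1)) atTop (nhds (F p₀)) := by
      simpa using tendsto_one_div_add_atTop_nhds_zero_nat.const_add (F p₀)
    exact le_of_tendsto_of_tendsto' hFlim (h1.comp hχ.tendsto_atTop) fun n => by
      have := hψlt (χ n)
      simp only [Function.comp_apply]
      linarith
  have hp : ∀ q, F p ≤ F q := fun q => hFp.trans (hp₀ q)
  obtain ⟨-, l, hl⟩ := key p hp
  have hl' := hl.comp (hψ.comp hχ).tendsto_atTop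
  have h0 : Tendsto (fun n => ‖v (ψ (χ n)) - p‖ ^ 2) atTop (nhds 0) := by
    have := (tendsto_iff_norm_sub_tendsto_zero.1 hlim).pow 2
    simpa using this
  obtain rfl : l = 0 := tendsto_nhds_unique hl' h0
  have h2 := hl.sqrt
  simp only [Real.sqrt_sq (norm_nonneg _), Real.sqrt_zero] at h2
  exact ⟨p, hp, tendsto_iff_norm_sub_tendsto_zero.2 h2⟩

/-- A differentiable convex function lies above its tangent planes. -/
theorem ConvexOn.add_inner_le_of_hasGradientAt {E : Type*} [NormedAddCommGroup E]
    [InnerProductSpace ℝ E] [CompleteSpace E] {f : E → ℝ} (hf : ConvexOn ℝ Set.univ f)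
    {p g : E} (hg : HasGradientAt f g p) (q : E) : f p + inner ℝ g (q - p) ≤ f q := by
  have hline : HasDerivAt (fun r : ℝ => p + r • (q - p)) (q - p) 0 := by
    simpa using ((hasDerivAt_id (0 : ℝ)).smul_const (q - p)).const_add p
  have hd : HasDerivAt (fun r : ℝ => f (p + r • (q - p))) (inner ℝ g (q - p)) 0 := by
    have hg' : HasFDerivAt f (InnerProductSpace.toDual ℝ E g) (p + (0 : ℝ) • (q - p)) := by
      simpa using hg.hasFDerivAt
    simpa [Function.comp_def] using hg'.comp_hasDerivAt (0 : ℝ) hline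
  have hc : ConvexOn ℝ Set.univ (fun r : ℝ => f (p + r • (q - p))) := by
    have := hf.comp_affineMap (AffineMap.lineMap (k := ℝ) p q)
    simpa [Function.comp_def, AffineMap.lineMap_apply, add_comm] using this
  have := hc.le_slope_of_hasDerivAt (Set.mem_univ 0) (Set.mem_univ 1) one_pos hd
  simp [slope_def_field] at this
  linarith

/-- A perturbed gradient method with summable perturbations, evaluated at inexact points,
converges to a minimizer of a sum of convex functions. -/
theorem exists_tendsto_minimizer_of_inexact_gradient {ι E : Type*} [Fintype ι]
    [NormedAddCommGroup E] [InnerProductSpace ℝ E] [ProperSpace E]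
    {f : ι → E → ℝ} {g : ι → E → E} {D : ℝ} (hD0 : 0 ≤ D)
    (hgrad : ∀ i x, HasGradientAt (f i) (g i x) x) (hD : ∀ i x, ‖g i x‖ ≤ D)
    (hconv : ∀ i, ConvexOn ℝ Set.univ (f i)) {v r : ℕ → E} {z : ℕ → ι → E} {β δ : ℕ → ℝ}
    (hβ0 : ∀ t, 0 ≤ β t) (hβ : ¬ Summable β) (hβ2 : Summable fun t => β t ^ 2)
    (hδ : ∀ t i, ‖z t i - v t‖ ≤ δ t) (hδ0 : ∀ t, 0 ≤ δ t) (hβδ : Summable fun t => β t * δ t)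
    (hr : Summable fun t => ‖r t‖)
    (hv : ∀ t, v (t + 1) = v t - β t • ∑ i, g i (z t i) + r t)
    (hne : ∃ p, ∀ q, ∑ i, f i p ≤ ∑ i, f i q) :
    ∃ p, (∀ q, ∑ i, f i p ≤ ∑ i, f i q) ∧ Tendsto v atTop (nhds p) := by
  have hF : Continuous fun p => ∑ i, f i p := continuous_finsetSum _ fun i _ =>
    continuous_iff_continuousAt.2 fun p => (hgrad i p).continuousAt
  refine exists_tendsto_minimizer_of_quasiFejer hF hβ0 hβ hne fun p hp => ?_
  set n : ℝ := (Fintype.card ι : ℝ)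
  set R := ∑' t, ‖r t‖
  have hR : ∀ t, ‖r t‖ ≤ R := fun t => hr.le_tsum t fun s _ => norm_nonneg _
  have hR0 : 0 ≤ R := (norm_nonneg _).trans (hR 0)
  have hn0 : 0 ≤ n := Nat.cast_nonneg _
  refine ⟨fun t => ‖r t‖,
    fun t => (1 + R) * (4 * n * D * (β t * δ t) + (n * D) ^ 2 * β t ^ 2) + (1 + R) * ‖r t‖,
    fun t => norm_nonneg _, fun t => ?_, hr,
    (((hβδ.mul_left _).add (hβ2.mul_left _)).mul_left _).add (hr.mul_left _), fun t => ?_⟩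
  · have := hβ0 t
    have := hδ0 t
    positivity
  set G := ∑ i, g i (z t i) with hG
  have hGn : ‖G‖ ≤ n * D := by
    refine (norm_sum_le_of_le _ fun i _ => hD i (z t i)).trans ?_
    simp [n]
  have hinner : ∑ i, f i (v t) - ∑ i, f i p - 2 * n * D * δ t ≤ inner ℝ G (v t - p) := by
    have hterm : ∀ i, f i (v t) - f i p - 2 * D * δ t ≤ inner ℝ (g i (z t i)) (v t - p) := by
      intro i
      have h1 := (hconv i).add_inner_le_of_hasGradientAt (hgrad i (z t i)) p
      have h2 := (hconv i).add_inner_le_of_hasGradientAt (hgrad i (v t)) (z t i)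
      have hDδ : ∀ q, ‖g i q‖ * ‖z t i - v t‖ ≤ D * δ t := fun q =>
        mul_le_mul (hD i q) (hδ t i) (norm_nonneg _) hD0
      have h3 := (abs_le.1 (abs_real_inner_le_norm (g i (v t)) (z t i - v t))).1
      have h4 := (abs_le.1 (abs_real_inner_le_norm (g i (z t i)) (z t i - v t))).2
      have h5 : (inner ℝ (g i (z t i)) (v t - p) : ℝ) =
          -inner ℝ (g i (z t i)) (p - z t i) - inner ℝ (g i (z t i)) (z t i - v t) := by
        simp only [inner_sub_right]; ring
      linarith [hDδ (v t), hDδ (z t i)]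
    have := sum_le_sum fun i (_ : i ∈ univ) => hterm i
    rw [← sum_inner, sum_sub_distrib, sum_sub_distrib] at this
    simp only [sum_const, card_univ, nsmul_eq_mul] at this
    linarith
  set a := v t - p
  set b := a - β t • G
  have hb : ‖b‖ ^ 2 ≤ ‖a‖ ^ 2 - 2 * β t * (∑ i, f i (v t) - ∑ i, f i p) +
      (4 * n * D * (β t * δ t) + (n * D) ^ 2 * β t ^ 2) := by
    have h1 : ‖b‖ ^ 2 = ‖a‖ ^ 2 - 2 * (β t * inner ℝ G a) + β t ^ 2 * ‖G‖ ^ 2 := by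
      rw [norm_sub_sq_real, inner_smul_right, real_inner_comm, norm_smul, mul_pow,
        Real.norm_eq_abs, sq_abs]
    have h2 : ‖G‖ ^ 2 ≤ (n * D) ^ 2 := pow_le_pow_left₀ (norm_nonneg _) hGn 2
    have h3 := mul_le_mul_of_nonneg_left hinner (hβ0 t)
    have h4 := mul_le_mul_of_nonneg_left h2 (sq_nonneg (β t))
    linarith
  have hvb : v (t + 1) - p = b + r t := by rw [hv]; simp only [b, a]; abel
  have hdec : 0 ≤ β t * (∑ i, f i (v t) - ∑ i, f i p) :=
    mul_nonneg (hβ0 t) (sub_nonneg.2 (hp _))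
  set K := 4 * n * D * (β t * δ t) + (n * D) ^ 2 * β t ^ 2
  have hK : 0 ≤ K := by
    have := hβ0 t
    have := hδ0 t
    positivity
  have hnorm : ‖v (t + 1) - p‖ ^ 2 ≤ (1 + ‖r t‖) * ‖b‖ ^ 2 + (1 + ‖r t‖) * ‖r t‖ := by
    rw [hvb]
    have h1 := pow_le_pow_left₀ (norm_nonneg _) (norm_add_le b (r t)) 2
    nlinarith [mul_nonneg (norm_nonneg (r t)) (sq_nonneg (‖b‖ - 1))]
  have hr0 := norm_nonneg (r t)
  have h1 := mul_le_mul_of_nonneg_left hb (by linarith : 0 ≤ 1 + ‖r t‖)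
  have h2 := mul_nonneg hr0 hdec
  have h3 := mul_le_mul_of_nonneg_right (hR t) hK
  have h4 := mul_le_mul_of_nonneg_right (hR t) hr0
  linarith

section Consensus

variable {m : ℕ} {E : Type*} [NormedAddCommGroup E] [NormedSpace ℝ E]
  {A : ℕ → Matrix (Fin m) (Fin m) ℝ} {h : ℕ → Fin m → E}

theorem sum_sum_smul_of_sum_col_eq_one {B : Matrix (Fin m) (Fin m) ℝ}
    (hB : ∀ j, ∑ i, B i j = 1) (k : Fin m → E) : ∑ i, ∑ j, B i j • k j = ∑ j, k j := by
  rw [sum_comm]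
  simp [← sum_smul, hB]

/-- Perturbed push-sum iterates agree with the mixing weights times their total, up to the
discounted size of the perturbations. -/
theorem norm_sum_smul_sub_smul_sum_le (hA_col : ∀ t j, ∑ i, A t i j = 1)
    {Aprod : ℕ → ℕ → Matrix (Fin m) (Fin m) ℝ} (hdiag : ∀ s, Aprod s s = A s)
    (hsucc : ∀ s t, s ≤ t → Aprod (t + 1) s = A (t + 1) * Aprod t s)
    {φ : ℕ → Fin m → ℝ} {C l : ℝ} (hC : 0 ≤ C) (hl : 0 ≤ l)
    (hmix : ∀ s t, s ≤ t → ∀ i j, |Aprod t s i j - φ t i| ≤ C * l ^ (t - s))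
    {U : ℕ → ℝ} (hU0 : ∑ i, ‖h 0 i‖ ≤ U 0)
    (hU : ∀ t, ∑ i, ‖h (t + 1) i - ∑ j, A t i j • h t j‖ ≤ U (t + 1)) (t : ℕ) (i : Fin m) :
    ‖∑ j, A t i j • h t j - φ t i • ∑ j, h t j‖ ≤ C * discountedSum l U t := by
  obtain ⟨u, hu0, hus⟩ : ∃ u : ℕ → Fin m → E, (∀ i, h 0 i = u 0 i) ∧
      ∀ t i, h (t + 1) i = ∑ j, A t i j • h t j + u (t + 1) i :=
    ⟨fun s i => Nat.casesOn s (h 0 i) fun t => h (t + 1) i - ∑ j, A t i j • h t j,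
      fun i => rfl, fun t i => by simp⟩
  have huU : ∀ s, ∑ i, ‖u s i‖ ≤ U s := by
    rintro (_ | s)
    · simpa only [← hu0] using hU0
    · simpa only [hus, add_sub_cancel_left] using hU s
  have hunroll : ∀ t i, ∑ j, A t i j • h t j =
      ∑ s ∈ range (t + 1), ∑ j, Aprod t s i j • u s j := by
    intro t
    induction t with
    | zero => intro i; simp [hdiag, hu0]
    | succ t ih =>
      intro i
      rw [sum_range_succ, hdiag]
      simp only [hus t, ih, smul_add, sum_add_distrib]
      congr 1
      simp only [smul_sum]
      rw [sum_comm]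
      refine sum_congr rfl fun s hs => ?_
      rw [hsucc s t (Nat.lt_succ_iff.1 (mem_range.1 hs)), sum_comm]
      simp only [Matrix.mul_apply, sum_smul, smul_smul]
  have htotal : ∀ t, ∑ j, h t j = ∑ s ∈ range (t + 1), ∑ j, u s j := by
    intro t
    induction t with
    | zero => simp [hu0]
    | succ t ih =>
      rw [sum_range_succ, ← ih]
      simp only [hus t, sum_add_distrib]
      rw [sum_sum_smul_of_sum_col_eq_one (hA_col t)]
  rw [hunroll, htotal, smul_sum, ← sum_sub_distrib, discountedSum, mul_sum]
  refine norm_sum_le_of_le _ fun s hs => ?_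
  have hst : s ≤ t := Nat.lt_succ_iff.1 (mem_range.1 hs)
  rw [smul_sum, ← sum_sub_distrib]
  calc ‖∑ j, (Aprod t s i j • u s j - φ t i • u s j)‖
      ≤ ∑ j, C * l ^ (t - s) * ‖u s j‖ := norm_sum_le_of_le _ fun j _ => by
        rw [← sub_smul, norm_smul]
        exact mul_le_mul_of_nonneg_right (hmix s t hst i j) (norm_nonneg _)
    _ = C * l ^ (t - s) * ∑ j, ‖u s j‖ := by rw [mul_sum]
    _ ≤ C * l ^ (t - s) * U s :=
        mul_le_mul_of_nonneg_left (huU s) (mul_nonneg hC (pow_nonneg hl _))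
    _ = _ := by ring

/-- Comparison of a ratio with the ratio of two common approximate multiples. -/
theorem norm_inv_smul_sub_inv_smul_le {w X : E} {y Y φ εw εy c c' : ℝ} (hc : 0 < c)
    (hc' : 0 < c') (hy : c ≤ y) (hY : c' ≤ Y) (hw : ‖w - φ • X‖ ≤ εw)
    (hyY : |y - φ * Y| ≤ εy) : ‖y⁻¹ • w - Y⁻¹ • X‖ ≤ c⁻¹ * (εw + c'⁻¹ * (εy * ‖X‖)) := by
  have hy0 : 0 < y := hc.trans_le hy
  have hY0 : 0 < Y := hc'.trans_le hY
  have hεy : 0 ≤ εy := (abs_nonneg _).trans hyY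
  have heq : y⁻¹ • w - Y⁻¹ • X = y⁻¹ • ((w - φ • X) - (Y⁻¹ * (y - φ * Y)) • X) := by
    simp only [smul_sub, smul_smul, sub_sub, ← add_smul]
    congr 2
    field_simp
    ring
  rw [heq, norm_smul, Real.norm_of_nonneg (inv_nonneg.2 hy0.le)]
  refine mul_le_mul (inv_anti₀ hc hy) ?_ (norm_nonneg _) (inv_nonneg.2 hc.le)
  refine (norm_sub_le _ _).trans (add_le_add hw ?_)
  rw [norm_smul, Real.norm_eq_abs, abs_mul, abs_of_pos (inv_pos.2 hY0), mul_assoc]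
  exact mul_le_mul (inv_anti₀ hc' hY) (mul_le_mul_of_nonneg_right hyY (norm_nonneg _))
    (by positivity) (by positivity)

end Consensus

theorem exists_pos_forall_le_of_eventually_le {ι : Type*} [Finite ι] {a : ℕ → ι → ℝ} {c : ℝ}
    (hc : 0 < c) (ha : ∀ t i, 0 < a t i) (h : ∀ᶠ t in atTop, ∀ i, c ≤ a t i) :
    ∃ c', 0 < c' ∧ ∀ t i, c' ≤ a t i := by
  obtain ⟨T, hT⟩ := eventually_atTop.1 h
  rcases isEmpty_or_nonempty ι with hι | hι
  · exact ⟨c, hc, fun t i => (hι.false i).elim⟩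
  obtain ⟨p, hp⟩ := Finite.exists_min fun p : Fin (T + 1) × ι => a p.1 p.2
  refine ⟨min c (a p.1 p.2), lt_min hc (ha _ _), fun t i => ?_⟩
  rcases le_total T t with ht | ht
  · exact (min_le_left _ _).trans (hT t ht i)
  · exact (min_le_right _ _).trans (hp (⟨t, Nat.lt_succ_iff.2 ht⟩, i))

/-- Theorem `maintheorem`: in the event-triggered gradient-push algorithm
with `Q > 0`, convex costs, `α` non-increasing with `∑ α(t+1) = ∞` and `∑ α(t+1)² < ∞`,
`τ` non-increasing with `∑_{t≥1} τ(t) < ∞`, `ζ` non-increasing with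
`∑ t^{3/2}ζ(t) < ∞` and `∑_{t≥1} ζ(t) < 1`, and the set `X*` of global minimizers of
`f = ∑_i f_i` nonempty, there exists `x* ∈ X*` such that `lim_{t→∞} ẑ_i(t) = x*`
for every `i`. (The iterates `ẑ_i(t)` are defined for `t ≥ 1`.) -/
theorem stmt_14
    (m d : ℕ) (hm : 1 ≤ m) (hd : 1 ≤ d)
    (A : ℕ → Matrix (Fin m) (Fin m) ℝ)
    (hA_nonneg : ∀ t i j, 0 ≤ A t i j)
    (hA_col : ∀ t j, ∑ i, A t i j = 1)
    (α τ ζ : ℕ → ℝ)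
    (hα_nonneg : ∀ t, 0 ≤ α t) (hτ_nonneg : ∀ t, 0 ≤ τ t) (hζ_nonneg : ∀ t, 0 ≤ ζ t)
    (D : ℝ)
    (f : Fin m → EuclideanSpace ℝ (Fin d) → ℝ)
    (g : Fin m → EuclideanSpace ℝ (Fin d) → EuclideanSpace ℝ (Fin d))
    (hgrad : ∀ i x, HasGradientAt (f i) (g i x) x)
    (hD : ∀ i x, ‖g i x‖ ≤ D)
    (x xh w z : ℕ → Fin m → EuclideanSpace ℝ (Fin d))
    (y yh : ℕ → Fin m → ℝ)
    (hxh0 : ∀ i, xh 0 i = x 0 i)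
    (hy0 : ∀ i, y 0 i = 1) (hyh0 : ∀ i, yh 0 i = 1)
    (hw : ∀ t i, w (t + 1) i = ∑ j, A t i j • xh t j)
    (hy : ∀ t i, y (t + 1) i = ∑ j, A t i j * yh t j)
    (hz : ∀ t i, z (t + 1) i = (y (t + 1) i)⁻¹ • w (t + 1) i)
    (hx : ∀ t i, x (t + 1) i = w (t + 1) i - α (t + 1) • g i (z (t + 1) i))
    (hxh_choice : ∀ t i, xh (t + 1) i = x (t + 1) i ∨ xh (t + 1) i = xh t i)
    (hxh_err : ∀ t i, ‖xh (t + 1) i - x (t + 1) i‖ ≤ τ (t + 1))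
    (hyh_choice : ∀ t i, yh (t + 1) i = y (t + 1) i ∨ yh (t + 1) i = yh t i)
    (hyh_err : ∀ t i, |yh (t + 1) i - y (t + 1) i| ≤ ζ (t + 1))
    (hypos : ∀ t i, 0 < y t i)
    (Aprod : ℕ → ℕ → Matrix (Fin m) (Fin m) ℝ)
    (hAprod_diag : ∀ s, Aprod s s = A s)
    (hAprod_succ : ∀ s t, s ≤ t → Aprod (t + 1) s = A (t + 1) * Aprod t s)
    (φ : ℕ → Fin m → ℝ)
    (hφ_nonneg : ∀ t i, 0 ≤ φ t i) (hφ_sum : ∀ t, ∑ i, φ t i = 1)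
    (C₀ lam : ℝ) (hC₀ : 1 ≤ C₀) (hlam : lam ∈ Set.Ioo (0 : ℝ) 1)
    (hmix : ∀ s t, s ≤ t → ∀ i j, |Aprod t s i j - φ t i| ≤ C₀ * lam ^ (t - s))
    (Q : ℝ) (hQdef : Q = ⨅ (t : ℕ) (i : Fin m), ∑ j, Aprod t 0 i j) (hQ : 0 < Q)
    (hconv : ∀ i, ConvexOn ℝ Set.univ (f i))
    (hα_mono : Antitone α)
    (hα_div : ¬ Summable (fun t : ℕ => α (t + 1)))
    (hα_sq : Summable (fun t : ℕ => α (t + 1) ^ 2))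
    (hτ_mono : Antitone τ) (hτ_sum : Summable τ)
    (hζ_mono : Antitone ζ)
    (hζ32 : Summable (fun t : ℕ => (t : ℝ) ^ (3/2 : ℝ) * ζ t))
    (hζ1 : ∑' t : ℕ, ζ (t + 1) < 1)
    (Xstar : Set (EuclideanSpace ℝ (Fin d)))
    (hXstar : Xstar = {p | ∀ q, ∑ i, f i p ≤ ∑ i, f i q})
    (hne : Xstar.Nonempty) :
    ∃ xstar ∈ Xstar, ∀ i, Tendsto (fun t : ℕ => z (t + 1) i) atTop (nhds xstar) := by
  obtain ⟨hl0, hl1⟩ := hlam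
  have hm0 : (0 : ℝ) < m := by exact_mod_cast hm
  have hD0 : 0 ≤ D := (norm_nonneg _).trans (hD ⟨0, hm⟩ 0)
  have hC : 0 ≤ C₀ := zero_le_one.trans hC₀
  have hα2 : Summable fun t => α t ^ 2 := (summable_nat_add_iff 1).1 hα_sq
  have hζt : Summable fun t : ℕ => ((t : ℝ) + 1) * ζ t := by
    rw [← summable_nat_add_iff 1] at hζ32 ⊢
    refine (hζ32.mul_left 2).of_nonneg_of_le
      (fun t => mul_nonneg (by positivity) (hζ_nonneg _)) fun t => ?_
    have h1 : (1 : ℝ) ≤ ((t + 1 : ℕ) : ℝ) := by push_cast; linarith [t.cast_nonneg (α := ℝ)]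
    have h2 : ((t + 1 : ℕ) : ℝ) ≤ ((t + 1 : ℕ) : ℝ) ^ (3 / 2 : ℝ) := by
      simpa using Real.rpow_le_rpow_of_exponent_le h1 (by norm_num : (1 : ℝ) ≤ 3 / 2)
    rw [← mul_assoc]
    exact mul_le_mul_of_nonneg_right (by linarith) (hζ_nonneg _)
  have hζs : Summable ζ := hζt.of_nonneg_of_le hζ_nonneg fun t =>
    le_mul_of_one_le_left (hζ_nonneg t) (by linarith [t.cast_nonneg (α := ℝ)])
  set X : ℕ → EuclideanSpace ℝ (Fin d) := fun t => ∑ j, xh t j with hX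
  set Y : ℕ → ℝ := fun t => ∑ j, yh t j with hY
  -- The total weight stays close to `m`.
  have hYstep : ∀ t, |Y (t + 1) - Y t| ≤ m * ζ (t + 1) := fun t => by
    have h1 : Y t = ∑ i, y (t + 1) i := by
      simp only [hY, hy]
      exact (sum_sum_smul_of_sum_col_eq_one (hA_col t) (yh t)).symm
    rw [h1, ← sum_sub_distrib]
    refine (abs_sum_le_sum_abs _ _).trans ((sum_le_sum fun i _ => hyh_err t i).trans ?_)
    simp
  set S := ∑' t : ℕ, ζ (t + 1)
  have hYm : ∀ t, |Y t - m| ≤ m * S := fun t => by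
    have h1 : |Y t - m| ≤ m * ∑ s ∈ range t, ζ (s + 1) := by
      induction t with
      | zero => simp [hY, hyh0]
      | succ t ih =>
        rw [sum_range_succ, mul_add]
        linarith [abs_sub_le (Y (t + 1)) (Y t) m, hYstep t]
    exact h1.trans (mul_le_mul_of_nonneg_left
      (((summable_nat_add_iff 1).2 hζs).sum_le_tsum _ fun s _ => hζ_nonneg _) hm0.le)
  set c₁ := (m : ℝ) * (1 - S)
  have hc₁ : 0 < c₁ := mul_pos hm0 (by linarith)
  have hYlow : ∀ t, c₁ ≤ Y t := fun t => by
    have : c₁ = m - m * S := by ring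
    linarith [(abs_le.1 (hYm t)).1]
  have hYup : ∀ t, Y t ≤ 2 * m := fun t => by
    nlinarith [(abs_le.1 (hYm t)).2]
  have hYpos : ∀ t, 0 < Y t := fun t => hc₁.trans_le (hYlow t)
  -- The total of the broadcast values grows at most linearly.
  have hXw : ∀ t, X t = ∑ i, w (t + 1) i := fun t => by
    simp only [hX, hw]
    exact (sum_sum_smul_of_sum_col_eq_one (hA_col t) (xh t)).symm
  have hXerr : ∀ t, ‖X (t + 1) - X t + α (t + 1) • ∑ i, g i (z (t + 1) i)‖ ≤ m * τ (t + 1) :=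
    fun t => by
      have h1 : X (t + 1) - X t + α (t + 1) • ∑ i, g i (z (t + 1) i) =
          ∑ i, (xh (t + 1) i - x (t + 1) i) := by
        rw [hXw t, smul_sum]
        simp only [hX, hx, ← sum_sub_distrib, ← sum_add_distrib]
        exact sum_congr rfl fun i _ => by abel
      rw [h1]
      refine (norm_sum_le_of_le _ fun i _ => hxh_err t i).trans ?_
      simp
  have hGle : ∀ t, ‖∑ i, g i (z (t + 1) i)‖ ≤ m * D := fun t => by
    refine (norm_sum_le_of_le _ fun i _ => hD i (z (t + 1) i)).trans ?_
    simp
  set K := ‖X 0‖ + m * (τ 0 + D * α 0)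
  have hK0 : 0 ≤ m * (τ 0 + D * α 0) :=
    mul_nonneg hm0.le (add_nonneg (hτ_nonneg 0) (mul_nonneg hD0 (hα_nonneg 0)))
  have hKnn : 0 ≤ K := add_nonneg (norm_nonneg _) hK0
  have hXle : ∀ t : ℕ, ‖X t‖ ≤ K * ((t : ℝ) + 1) := fun t => by
    induction t with
    | zero => simp only [CharP.cast_eq_zero, zero_add, mul_one, K]; linarith
    | succ t ih =>
      set G := ∑ i, g i (z (t + 1) i)
      have h1 : X (t + 1) = X t + (X (t + 1) - X t + α (t + 1) • G) - α (t + 1) • G := by abel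
      have h2 : ‖α (t + 1) • G‖ ≤ α 0 * (m * D) := by
        rw [norm_smul, Real.norm_of_nonneg (hα_nonneg _)]
        exact mul_le_mul (hα_mono (Nat.zero_le _)) (hGle t) (norm_nonneg _) (hα_nonneg 0)
      have h3 : (m : ℝ) * τ (t + 1) ≤ m * τ 0 :=
        mul_le_mul_of_nonneg_left (hτ_mono (Nat.zero_le _)) hm0.le
      have h4 := (norm_sub_le (X t + (X (t + 1) - X t + α (t + 1) • G)) (α (t + 1) • G)).trans
        (add_le_add_left (norm_add_le _ _) _)
      rw [← h1] at h4
      have h5 : (m : ℝ) * (τ 0 + D * α 0) ≤ K := le_add_of_nonneg_left (norm_nonneg _)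
      push_cast
      linarith [hXerr t]
  -- Consensus errors.
  set T : ℕ → ℝ := fun s => m * τ s + if s = 0 then ∑ j, ‖xh 0 j‖ else 0 with hT
  set V : ℕ → ℝ := fun s => m * ζ s + if s = 0 then (m : ℝ) else 0 with hV
  have hT0 : ∀ s, 0 ≤ T s := fun s => add_nonneg (mul_nonneg hm0.le (hτ_nonneg s)) (by
    split_ifs
    · exact sum_nonneg fun j _ => norm_nonneg _
    · exact le_rfl)
  have hV0 : ∀ s, 0 ≤ V s := fun s => add_nonneg (mul_nonneg hm0.le (hζ_nonneg s)) (by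
    split_ifs
    · exact hm0.le
    · exact le_rfl)
  have hTs : Summable T := (hτ_sum.mul_left _).add (hasSum_ite_eq 0 _).summable
  have hVs : Summable fun t : ℕ => ((t : ℝ) + 1) * V t := by
    refine ((hζt.mul_left (m : ℝ)).add (hasSum_ite_eq 0 (m : ℝ)).summable).congr fun t => ?_
    simp only [hV]
    split_ifs with h
    · simp [h]
    · ring
  set εw : ℕ → ℝ := fun t => C₀ * (discountedSum lam T t + (m * D) * discountedSum lam α t)
  set εy : ℕ → ℝ := fun t => C₀ * discountedSum lam V t
  have hεw : ∀ t i, ‖w (t + 1) i - φ t i • X t‖ ≤ εw t := fun t i => by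
    have h1 := norm_sum_smul_sub_smul_sum_le (h := xh) (U := fun s => T s + (m * D) * α s)
      hA_col hAprod_diag hAprod_succ hC hl0.le hmix ?_ (fun t => ?_) t i
    · rwa [discountedSum_add_mul, ← hw] at h1
    · have h2 : 0 ≤ (m : ℝ) * τ 0 := mul_nonneg hm0.le (hτ_nonneg 0)
      have h3 : 0 ≤ (m : ℝ) * D * α 0 := mul_nonneg (mul_nonneg hm0.le hD0) (hα_nonneg 0)
      simp only [hT, if_true]
      linarith
    · have h2 : ∀ i, ‖xh (t + 1) i - ∑ j, A t i j • xh t j‖ ≤ τ (t + 1) + D * α (t + 1) := by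
        intro i
        have h3 : xh (t + 1) i - ∑ j, A t i j • xh t j =
            (xh (t + 1) i - x (t + 1) i) - α (t + 1) • g i (z (t + 1) i) := by
          rw [← hw, hx]; abel
        rw [h3]
        refine (norm_sub_le _ _).trans (add_le_add (hxh_err t i) ?_)
        rw [norm_smul, Real.norm_of_nonneg (hα_nonneg _), mul_comm]
        exact mul_le_mul_of_nonneg_right (hD _ _) (hα_nonneg _)
      refine (sum_le_sum fun i _ => h2 i).trans (le_of_eq ?_)
      simp only [hT, sum_const, card_univ, Fintype.card_fin, nsmul_eq_mul, Nat.succ_ne_zero,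
        if_false]
      ring
  have hεy : ∀ t i, |y (t + 1) i - φ t i * Y t| ≤ εy t := fun t i => by
    have h1 := norm_sum_smul_sub_smul_sum_le (h := yh) (U := V)
      hA_col hAprod_diag hAprod_succ hC hl0.le hmix ?_ (fun t => ?_) t i
    · simpa only [smul_eq_mul, ← hy, Real.norm_eq_abs] using h1
    · simpa [hV, hyh0] using mul_nonneg hm0.le (hζ_nonneg 0)
    · simp only [smul_eq_mul, ← hy, Real.norm_eq_abs]
      refine (sum_le_sum fun i _ => hyh_err t i).trans (le_of_eq ?_)
      simp [hV]
  have hsV := summable_succ_mul_discountedSum hl0.le hl1 hV0 hVs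
  have hsT := summable_discountedSum hl0.le hl1 hT0 hTs
  have hdV0 := discountedSum_nonneg hl0.le hV0
  have hdT0 := discountedSum_nonneg hl0.le hT0
  have hdα0 := discountedSum_nonneg hl0.le hα_nonneg
  -- The weights are bounded away from zero.
  obtain ⟨c, hc, hcy⟩ : ∃ c, 0 < c ∧ ∀ t i, c ≤ y (t + 1) i := by
    have hQle : ∀ t i, Q ≤ ∑ j, Aprod t 0 i j := fun t i => by
      have hb : BddBelow (Set.range fun t : ℕ => ⨅ i : Fin m, ∑ j, Aprod t 0 i j) := by
        by_contra hb
        rw [Real.iInf_of_not_bddBelow hb] at hQdef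
        exact hQ.ne' hQdef
      rw [hQdef]
      exact (ciInf_le hb t).trans (ciInf_le (Set.finite_range _).bddBelow i)
    have hφQ : ∀ t i, Q / m - C₀ * lam ^ t ≤ φ t i := fun t i => by
      have h1 : ∑ j, Aprod t 0 i j ≤ ∑ _j : Fin m, (φ t i + C₀ * lam ^ t) :=
        sum_le_sum fun j _ => by
          have := (abs_le.1 (hmix 0 t (Nat.zero_le t) i j)).2
          rw [Nat.sub_zero] at this
          linarith
      have h2 := (hQle t i).trans h1
      simp only [sum_const, card_univ, Fintype.card_fin, nsmul_eq_mul] at h2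
      rw [sub_le_iff_le_add, div_le_iff₀ hm0]
      linarith
    have hlim : Tendsto (fun t => c₁ * (Q / m - C₀ * lam ^ t) - εy t) atTop
        (nhds (c₁ * (Q / m))) := by
      have h1 := (tendsto_pow_atTop_nhds_zero_of_lt_one hl0.le hl1).const_mul C₀
      have h2 : Summable (discountedSum lam V) := hsV.of_nonneg_of_le hdV0 fun t =>
        le_mul_of_one_le_left (hdV0 t) (by linarith [t.cast_nonneg (α := ℝ)])
      have h3 := h2.tendsto_atTop_zero.const_mul C₀
      simpa using ((h1.const_sub (Q / m)).const_mul c₁).sub h3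
    have hpos : 0 < c₁ * (Q / m) := mul_pos hc₁ (div_pos hQ hm0)
    refine exists_pos_forall_le_of_eventually_le (half_pos hpos) (fun t i => hypos (t + 1) i) ?_
    filter_upwards [hlim.eventually (lt_mem_nhds (half_lt_self hpos))] with t ht i
    have h1 := (abs_le.1 (hεy t i)).1
    have h2 := mul_le_mul_of_nonneg_left (hYlow t) (hφ_nonneg t i)
    have h3 := mul_le_mul_of_nonneg_left (hφQ t i) hc₁.le
    linarith
  set v : ℕ → EuclideanSpace ℝ (Fin d) := fun t => (Y t)⁻¹ • X t with hv
  set δ : ℕ → ℝ := fun t =>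
    c⁻¹ * (εw t + c₁⁻¹ * (K * (C₀ * (((t : ℝ) + 1) * discountedSum lam V t))))
  have hzv : ∀ t i, ‖z (t + 1) i - v t‖ ≤ δ t := fun t i => by
    rw [hz]
    refine (norm_inv_smul_sub_inv_smul_le hc hc₁ (hcy t i) (hYlow t) (hεw t i)
      (hεy t i)).trans ?_
    have h1 : 0 ≤ εy t := mul_nonneg hC (hdV0 t)
    have h2 := mul_le_mul_of_nonneg_left (hXle t) h1
    have h3 : εy t * (K * ((t : ℝ) + 1)) =
        K * (C₀ * (((t : ℝ) + 1) * discountedSum lam V t)) := by simp only [εy]; ring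
    rw [h3] at h2
    simp only [δ]
    gcongr
  have hδ0 : ∀ t, 0 ≤ δ t := fun t => (norm_nonneg _).trans (hzv t ⟨0, hm⟩)
  have hδlim : Tendsto δ atTop (nhds 0) := by
    have h1 := hsT.tendsto_atTop_zero
    have h2 := tendsto_discountedSum_of_summable_sq hl0.le hl1 hα2
    have h3 := hsV.tendsto_atTop_zero
    simpa using (((h1.add (h2.const_mul (m * D))).const_mul C₀).add
      (((h3.const_mul C₀).const_mul K).const_mul c₁⁻¹)).const_mul c⁻¹
  have hbdd : ∀ {a : ℕ → ℝ}, (∀ t, 0 ≤ a t) → Summable a →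
      Summable fun t => α (t + 1) * a t := fun {a} ha has =>
    (has.mul_left (α 0)).of_nonneg_of_le (fun t => mul_nonneg (hα_nonneg _) (ha t)) fun t =>
      mul_le_mul_of_nonneg_right (hα_mono (Nat.zero_le _)) (ha t)
  have hαδ : Summable fun t => α (t + 1) * δ t := by
    have h1 := hbdd hdT0 hsT
    have h2 := summable_mul_discountedSum_self hl0.le hl1 hα_nonneg hα_mono hα2
    have h3 := hbdd (fun t => mul_nonneg (by positivity) (hdV0 t)) hsV
    refine ((((h1.add (h2.mul_left (m * D))).mul_left C₀).add
      (((h3.mul_left C₀).mul_left K).mul_left c₁⁻¹)).mul_left c⁻¹).congr fun t => ?_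
    simp only [δ, εw]
    ring
  set β : ℕ → ℝ := fun t => (Y (t + 1))⁻¹ * α (t + 1)
  have hYinv : ∀ t, (Y t)⁻¹ ≤ c₁⁻¹ := fun t => inv_anti₀ hc₁ (hYlow t)
  have hYinv0 : ∀ t, 0 ≤ (Y t)⁻¹ := fun t => (inv_pos.2 (hYpos t)).le
  have hβ0 : ∀ t, 0 ≤ β t := fun t => mul_nonneg (hYinv0 _) (hα_nonneg _)
  have hβle : ∀ t, β t ≤ c₁⁻¹ * α (t + 1) := fun t =>
    mul_le_mul_of_nonneg_right (hYinv _) (hα_nonneg _)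
  have hβ : ¬ Summable β := fun hs => hα_div <|
    (hs.mul_left (2 * m : ℝ)).of_nonneg_of_le (fun t => hα_nonneg _) fun t => by
      have h1 : α (t + 1) = Y (t + 1) * β t := by
        simp only [β]
        rw [mul_inv_cancel_left₀ (hYpos _).ne']
      rw [h1]
      exact mul_le_mul_of_nonneg_right (hYup _) (hβ0 t)
  have hβ2 : Summable fun t => β t ^ 2 :=
    (hα_sq.mul_left (c₁⁻¹ ^ 2)).of_nonneg_of_le (fun t => sq_nonneg _) fun t => by
      rw [← mul_pow]
      exact pow_le_pow_left₀ (hβ0 t) (hβle t) 2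
  have hβδ : Summable fun t => β t * δ t :=
    (hαδ.mul_left c₁⁻¹).of_nonneg_of_le (fun t => mul_nonneg (hβ0 t) (hδ0 t)) fun t =>
      (mul_le_mul_of_nonneg_right (hβle t) (hδ0 t)).trans_eq (mul_assoc _ _ _)
  set r : ℕ → EuclideanSpace ℝ (Fin d) := fun t =>
    v (t + 1) - v t + β t • ∑ i, g i (z (t + 1) i) with hr
  have hrs : Summable fun t => ‖r t‖ := by
    have hτ' := (summable_nat_add_iff 1).2 hτ_sum
    have hζ' := (summable_nat_add_iff 1).2 hζt
    refine ((hτ'.mul_left (c₁⁻¹ * m)).add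
      (hζ'.mul_left (c₁⁻¹ * c₁⁻¹ * m * K))).of_nonneg_of_le (fun t => norm_nonneg _) fun t => ?_
    have h1 : r t = (Y (t + 1))⁻¹ • (X (t + 1) - X t + α (t + 1) • ∑ i, g i (z (t + 1) i)) +
        ((Y (t + 1))⁻¹ * (Y t)⁻¹ * (Y t - Y (t + 1))) • X t := by
      have h2 : (Y (t + 1))⁻¹ * (Y t)⁻¹ * (Y t - Y (t + 1)) = (Y (t + 1))⁻¹ - (Y t)⁻¹ := by
        have := (hYpos t).ne'
        have := (hYpos (t + 1)).ne'
        field_simp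
      rw [h2]
      simp only [hr, hv, β, smul_add, smul_sub, sub_smul, smul_smul]
      abel
    rw [h1]
    refine (norm_add_le _ _).trans (add_le_add ?_ ?_)
    · rw [norm_smul, Real.norm_of_nonneg (hYinv0 _), mul_assoc]
      exact mul_le_mul (hYinv _) (hXerr t) (norm_nonneg _) (inv_pos.2 hc₁).le
    · rw [norm_smul, norm_mul, norm_mul, Real.norm_of_nonneg (hYinv0 _),
        Real.norm_of_nonneg (hYinv0 _), Real.norm_eq_abs, abs_sub_comm]
      have h3 := hζ_nonneg (t + 1)
      have h4 := hYinv0 t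
      have h5 := hYinv0 (t + 1)
      have h6 : K * ((t : ℝ) + 1) ≤ K * (((t + 1 : ℕ) : ℝ) + 1) := by
        push_cast
        exact mul_le_mul_of_nonneg_left (by linarith) hKnn
      calc (Y (t + 1))⁻¹ * (Y t)⁻¹ * |Y (t + 1) - Y t| * ‖X t‖
          ≤ c₁⁻¹ * c₁⁻¹ * (m * ζ (t + 1)) * (K * (((t + 1 : ℕ) : ℝ) + 1)) := by
            have h7 := hYinv t
            have h8 := hYinv (t + 1)
            have h9 := hYstep t
            have h10 := (hXle t).trans h6
            gcongr
        _ = _ := by ring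
  subst hXstar
  obtain ⟨p, hp, hlim⟩ := exists_tendsto_minimizer_of_inexact_gradient
    (z := fun t => z (t + 1)) hD0 hgrad hD hconv hβ0 hβ hβ2 hzv hδ0 hβδ hrs
    (fun t => by simp only [hr]; abel) hne
  refine ⟨p, hp, fun i => ?_⟩
  have h1 : Tendsto (fun t => z (t + 1) i - v t) atTop (nhds 0) :=
    squeeze_zero_norm (fun t => hzv t i) hδlim
  simpa using h1.add hlim
end

section
/- For every λ ∈ (0,1) and every integer T ≥ 0: ∑_{t=1}^{T+1} (1/√t) ∑_{s=1}^{t} λ^{t−s} (1/√s) ≤ (1 + ln(T+1))/(1−λ). -/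
open Finset

lemma geom_sum_Icc_le {r : ℝ} (hr0 : 0 ≤ r) (hr1 : r < 1) (m n : ℕ) :
    ∑ t ∈ Finset.Icc m n, r ^ (t - m) ≤ 1 / (1 - r) := by
  rw [← Finset.Ico_add_one_right_eq_Icc, Finset.sum_Ico_eq_sum_range]
  simp only [Nat.add_sub_cancel_left]
  rw [le_div_iff₀ (by linarith), geom_sum_mul_neg]
  linarith [pow_nonneg hr0 (n + 1 - m)]

lemma one_div_sqrt_mul_one_div_sqrt_le {x y : ℝ} (hx : 0 < x) (hxy : x ≤ y) :
    (1 / Real.sqrt y) * (1 / Real.sqrt x) ≤ x⁻¹ := by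
  have hsx : 0 < Real.sqrt x := Real.sqrt_pos.2 hx
  calc (1 / Real.sqrt y) * (1 / Real.sqrt x)
      ≤ (1 / Real.sqrt x) * (1 / Real.sqrt x) := by gcongr
    _ = x⁻¹ := by rw [one_div_mul_one_div_rev, Real.mul_self_sqrt hx.le, one_div]

/-- For every `λ ∈ (0,1)` and every integer `T ≥ 0`:
`∑_{t=1}^{T+1} (1/√t) ∑_{s=1}^{t} λ^{t−s} (1/√s) ≤ (1 + ln(T+1))/(1−λ)`. -/
theorem stmt_16
    (lam : ℝ) (hlam0 : 0 < lam) (hlam1 : lam < 1) (T : ℕ) :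
    ∑ t ∈ Finset.Icc 1 (T + 1), (1 / Real.sqrt t) *
        ∑ s ∈ Finset.Icc 1 t, lam ^ (t - s) * (1 / Real.sqrt s)
      ≤ (1 + Real.log (T + 1)) / (1 - lam) := by
  have hharm : ∑ s ∈ Finset.Icc 1 (T + 1), (s : ℝ)⁻¹ ≤ 1 + Real.log (T + 1) := by
    have h := harmonic_le_one_add_log (T + 1)
    rw [harmonic_eq_sum_Icc] at h
    push_cast at h
    exact h
  calc ∑ t ∈ Finset.Icc 1 (T + 1), (1 / Real.sqrt t) *
        ∑ s ∈ Finset.Icc 1 t, lam ^ (t - s) * (1 / Real.sqrt s)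
      ≤ ∑ t ∈ Finset.Icc 1 (T + 1), ∑ s ∈ Finset.Icc 1 t, (s : ℝ)⁻¹ * lam ^ (t - s) := by
        refine Finset.sum_le_sum fun t _ => ?_
        rw [Finset.mul_sum]
        refine Finset.sum_le_sum fun s hs => ?_
        obtain ⟨hs1, hst⟩ := Finset.mem_Icc.1 hs
        rw [mul_left_comm, mul_comm]
        gcongr
        exact one_div_sqrt_mul_one_div_sqrt_le (by exact_mod_cast hs1) (by exact_mod_cast hst)
    _ = ∑ s ∈ Finset.Icc 1 (T + 1), ∑ t ∈ Finset.Icc s (T + 1), (s : ℝ)⁻¹ * lam ^ (t - s) := by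
        refine Finset.sum_comm' fun t s => ?_
        simp only [Finset.mem_Icc]
        omega
    _ ≤ ∑ s ∈ Finset.Icc 1 (T + 1), (s : ℝ)⁻¹ * (1 / (1 - lam)) := by
        refine Finset.sum_le_sum fun s _ => ?_
        rw [← Finset.mul_sum]
        gcongr
        exact geom_sum_Icc_le hlam0.le hlam1 s (T + 1)
    _ ≤ (1 + Real.log (T + 1)) / (1 - lam) := by
        rw [← Finset.sum_mul, mul_one_div]
        have : 0 < 1 - lam := by linarith
        gcongr
end

section
/- If α : ℕ → [0,∞) is non-increasing and λ ∈ (0,1), then ∑_{t=1}^∞ α(t+1) ∑_{s=0}^{t−1} λ^{t−s−1} α(s+1) ≤ (1/(1−λ)) ∑_{s=0}^∞ α(s+1)². -/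
open Finset

theorem sum_range_succ_pow_sub_mul (b : ℕ → ℝ) (r : ℝ) (t : ℕ) :
    ∑ s ∈ Finset.range (t + 1), r ^ (t + 1 - s - 1) * b s
      = r * ∑ s ∈ Finset.range t, r ^ (t - s - 1) * b s + b t := by
  rw [Finset.sum_range_succ, Finset.mul_sum]
  congr 1
  · refine Finset.sum_congr rfl fun s hs => ?_
    have hst : s < t := Finset.mem_range.mp hs
    rw [show t + 1 - s - 1 = (t - s - 1) + 1 by omega, pow_succ]
    ring
  · simp

/-- The partial sums of a geometric convolution telescope. -/
theorem one_sub_mul_sum_range_geom_conv (b : ℕ → ℝ) (r : ℝ) (n : ℕ) :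
    (1 - r) * ∑ t ∈ Finset.range n, ∑ s ∈ Finset.range t, r ^ (t - s - 1) * b s
      + ∑ s ∈ Finset.range n, r ^ (n - s - 1) * b s = ∑ s ∈ Finset.range n, b s := by
  induction n with
  | zero => simp
  | succ n ih =>
    rw [sum_range_succ_pow_sub_mul, Finset.sum_range_succ, Finset.sum_range_succ b]
    linear_combination ih

theorem sum_range_geom_conv_le {b : ℕ → ℝ} (hb : ∀ s, 0 ≤ b s) {r : ℝ} (hr0 : 0 ≤ r)
    (hr1 : r < 1) (n : ℕ) :
    ∑ t ∈ Finset.range n, ∑ s ∈ Finset.range t, r ^ (t - s - 1) * b s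
      ≤ 1 / (1 - r) * ∑ s ∈ Finset.range n, b s := by
  have hpos : 0 < 1 - r := sub_pos.mpr hr1
  rw [one_div_mul_eq_div, le_div_iff₀' hpos, ← one_sub_mul_sum_range_geom_conv b r n]
  exact le_add_of_nonneg_right
    (Finset.sum_nonneg fun s _ => mul_nonneg (pow_nonneg hr0 _) (hb s))

theorem mul_sum_range_geom_le_of_antitone {α : ℕ → ℝ} (hα_nonneg : ∀ t, 0 ≤ α t)
    (hα_mono : Antitone α) {r : ℝ} (hr : 0 ≤ r) (t : ℕ) :
    α (t + 1) * ∑ s ∈ Finset.range t, r ^ (t - s - 1) * α (s + 1)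
      ≤ ∑ s ∈ Finset.range t, r ^ (t - s - 1) * α (s + 1) ^ 2 := by
  rw [Finset.mul_sum]
  refine Finset.sum_le_sum fun s hs => ?_
  have hst : α (t + 1) ≤ α (s + 1) :=
    hα_mono (Nat.succ_le_succ (Finset.mem_range.mp hs).le)
  calc α (t + 1) * (r ^ (t - s - 1) * α (s + 1))
      ≤ α (s + 1) * (r ^ (t - s - 1) * α (s + 1)) :=
        mul_le_mul_of_nonneg_right hst (mul_nonneg (pow_nonneg hr _) (hα_nonneg _))
    _ = r ^ (t - s - 1) * α (s + 1) ^ 2 := by ring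

/-- If `α : ℕ → [0,∞)` is non-increasing and `λ ∈ (0,1)`, then
`∑_{t=1}^∞ α(t+1) ∑_{s=0}^{t−1} λ^{t−s−1} α(s+1) ≤ (1/(1−λ)) ∑_{s=0}^∞ α(s+1)²`,
where both sides may be `+∞` and the inequality is understood in `[0,∞]`.
(The `t = 0` term of the outer sum is an empty sum, so summing over all `t : ℕ`
is the same as summing over `t ≥ 1`.) -/
theorem stmt_17
    (α : ℕ → ℝ) (hα_nonneg : ∀ t, 0 ≤ α t) (hα_mono : Antitone α)
    (lam : ℝ) (hlam0 : 0 < lam) (hlam1 : lam < 1) :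
    ∑' t : ℕ, ENNReal.ofReal (α (t + 1) * ∑ s ∈ Finset.range t, lam ^ (t - s - 1) * α (s + 1))
      ≤ ENNReal.ofReal (1 / (1 - lam)) * ∑' s : ℕ, ENNReal.ofReal (α (s + 1) ^ 2) := by
  refine ENNReal.tsum_le_of_sum_range_le fun n => ?_
  rw [← ENNReal.ofReal_sum_of_nonneg fun t _ => mul_nonneg (hα_nonneg _)
    (Finset.sum_nonneg fun s _ => mul_nonneg (pow_nonneg hlam0.le _) (hα_nonneg _))]
  calc _ ≤ ENNReal.ofReal (1 / (1 - lam) * ∑ s ∈ Finset.range n, α (s + 1) ^ 2) :=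
        ENNReal.ofReal_le_ofReal <| (Finset.sum_le_sum fun t _ =>
          mul_sum_range_geom_le_of_antitone hα_nonneg hα_mono hlam0.le t).trans
            (sum_range_geom_conv_le (fun s => sq_nonneg (α (s + 1))) hlam0.le hlam1 n)
    _ = ENNReal.ofReal (1 / (1 - lam)) *
          ∑ s ∈ Finset.range n, ENNReal.ofReal (α (s + 1) ^ 2) := by
        rw [ENNReal.ofReal_mul (one_div_nonneg.mpr (sub_nonneg.mpr hlam1.le)),
          ENNReal.ofReal_sum_of_nonneg fun s _ => sq_nonneg _]
    _ ≤ _ := mul_le_mul_right (ENNReal.sum_le_tsum _) _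
end
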